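/- Non-complication theorem: Let G be a homogeneous m-generic L-graph and let 𝒜 ⊆ O(G) be a C_{ij}-cover set. Then there are distinct k, l ∈ {0,…,m−1} ∖ {i,j} such that O(G) contains a C_{ij}^{kl}-omission set based on 𝒜. -/

import Mathlib

/-!
Common framework: coloured multipartite graphs in a finite language `L`.
Colours are natural numbers; for each pair of distinct parts `i j : Fin m`
there is a finite nonempty colour set `C i j`.
-/

/-- A finite language for coloured `m`-partite graphs. -/
structure MLang (m : ℕ) where
  C : Fin m → Fin m → Finset ℕ
  symm : ∀ i j, C i j = C j i
  nonempty : ∀ i j, i ≠ j → (C i j).Nonempty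

/-- A coloured `m`-partite `L`-graph: vertices partitioned into parts `V_0, …, V_{m-1}`,
with a symmetric colouring of cross-part pairs taking values in the colour sets of `L`.
(The value of `colour` on pairs within a part is irrelevant junk data.) -/
structure LGraph {m : ℕ} (L : MLang m) where
  V : Type
  part : V → Fin m
  colour : V → V → ℕ
  colour_symm : ∀ x y, colour x y = colour y x
  colour_mem : ∀ x y, part x ≠ part y → colour x y ∈ L.C (part x) (part y)

namespace LGraph

variable {m : ℕ} {L : MLang m}

/-- The induced subgraph of `A` on a set `S` of its vertices. -/
def restrict (A : LGraph L) (S : Set A.V) : LGraph L where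
  V := S
  part x := A.part x.1
  colour x y := A.colour x.1 y.1
  colour_symm := fun x y => A.colour_symm x.1 y.1
  colour_mem := fun x y h => A.colour_mem x.1 y.1 h

/-- `f` is an embedding of `A` into `G`: injective, part-preserving, colour-preserving. -/
def IsEmbedding (A G : LGraph L) (f : A.V → G.V) : Prop :=
  Function.Injective f ∧ (∀ x, G.part (f x) = A.part x) ∧
    ∀ x y : A.V, A.part x ≠ A.part y → G.colour (f x) (f y) = A.colour x y

/-- `A` is realized in `G`, i.e. `A` embeds into `G`. -/
def Realized (G A : LGraph L) : Prop := ∃ f : A.V → G.V, IsEmbedding A G f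

/-- `A` and `B` are isomorphic `L`-graphs. -/
def IsIsomorphic (A B : LGraph L) : Prop :=
  ∃ f : A.V → B.V, IsEmbedding A B f ∧ Function.Surjective f

/-- `φ` restricted to `S` is an isomorphism between induced subgraphs of `G`
(a partial automorphism of `G`). -/
def IsPartialIso (G : LGraph L) (S : Set G.V) (φ : G.V → G.V) : Prop :=
  Set.InjOn φ S ∧ (∀ x ∈ S, G.part (φ x) = G.part x) ∧
    ∀ x ∈ S, ∀ y ∈ S, G.part x ≠ G.part y → G.colour (φ x) (φ y) = G.colour x y

/-- `G` is homogeneous: every isomorphism between finite induced subgraphs of `G`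
extends to an automorphism of `G`. -/
def Homogeneous (G : LGraph L) : Prop :=
  ∀ S : Set G.V, S.Finite → ∀ φ : G.V → G.V, G.IsPartialIso S φ →
    ∃ ψ : G.V ≃ G.V, (∀ x, G.part (ψ x) = G.part x) ∧
      (∀ x y : G.V, G.part x ≠ G.part y → G.colour (ψ x) (ψ y) = G.colour x y) ∧
      ∀ x ∈ S, ψ x = φ x

/-- `G` is `m`-generic: every part is countably infinite and every bipartite
restriction is generic. -/
def Generic (G : LGraph L) : Prop :=
  Countable G.V ∧ (∀ i : Fin m, {x : G.V | G.part x = i}.Infinite) ∧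
    ∀ i j : Fin m, i ≠ j → ∀ U : Finset G.V, (∀ u ∈ U, G.part u = i) →
      ∀ f : G.V → ℕ, (∀ u ∈ U, f u ∈ L.C i j) →
        ∃ x : G.V, G.part x = j ∧ ∀ u ∈ U, G.colour x u = f u

/-- `A` is minimally omitted from `G` (membership in `O(G)`): `A` is finite and omitted,
but every proper induced subgraph of `A` is realized in `G`. -/
def MinOmitted (G A : LGraph L) : Prop :=
  Finite A.V ∧ ¬ G.Realized A ∧ ∀ S : Set A.V, S ≠ Set.univ → G.Realized (A.restrict S)

/-- `A` is monic: at most one vertex in each part. -/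
def Monic (A : LGraph L) : Prop := ∀ x y : A.V, A.part x = A.part y → x = y

/-- `A` covers colour `c` on the restriction `V_i V_j`: it has vertices in `V_i` and `V_j`
joined by a `c`-coloured edge. -/
def Covers (A : LGraph L) (i j : Fin m) (c : ℕ) : Prop :=
  ∃ x y : A.V, A.part x = i ∧ A.part y = j ∧ A.colour x y = c

/-- `A` is an `ijk`-triangle: a monic with vertices in exactly the parts `V_i, V_j, V_k`. -/
def IsTriangleOn (A : LGraph L) (i j k : Fin m) : Prop :=
  A.Monic ∧ (∀ x : A.V, A.part x = i ∨ A.part x = j ∨ A.part x = k) ∧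
    (∃ x : A.V, A.part x = i) ∧ (∃ x : A.V, A.part x = j) ∧ (∃ x : A.V, A.part x = k)

/-- `A` is a triangle: an `ijk`-triangle for some pairwise distinct `i, j, k`. -/
def IsTriangle (A : LGraph L) : Prop :=
  ∃ i j k : Fin m, i ≠ j ∧ i ≠ k ∧ j ≠ k ∧ A.IsTriangleOn i j k

end LGraph

open LGraph

variable {m : ℕ} {L : MLang m}

/-- A `C_{ij}`-cover set: a set of monics covering every colour of `C i j` on `V_i V_j`. -/
def IsCoverSet (𝒜 : Set (LGraph L)) (i j : Fin m) : Prop :=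
  (∀ A ∈ 𝒜, A.Monic) ∧ ∀ c ∈ L.C i j, ∃ A ∈ 𝒜, A.Covers i j c

/-- A `C_{ij}^{kl}`-omission set with code `(i,j,k,l; cik, cil, cjk, cjl)`:
a `C_{ij}`-cover set of `ijk`-triangles and `ijl`-triangles all of whose
`E_{ik}, E_{il}, E_{jk}, E_{jl}`-edges have the indicated colours. -/
def IsOmissionSet (S : Set (LGraph L)) (i j k l : Fin m) (cik cil cjk cjl : ℕ) : Prop :=
  IsCoverSet S i j ∧
  (∀ A ∈ S, A.IsTriangleOn i j k ∨ A.IsTriangleOn i j l) ∧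
  (∀ A ∈ S, ∀ x y : A.V, A.part x = i → A.part y = k → A.colour x y = cik) ∧
  (∀ A ∈ S, ∀ x y : A.V, A.part x = i → A.part y = l → A.colour x y = cil) ∧
  (∀ A ∈ S, ∀ x y : A.V, A.part x = j → A.part y = k → A.colour x y = cjk) ∧
  (∀ A ∈ S, ∀ x y : A.V, A.part x = j → A.part y = l → A.colour x y = cjl)

/-- The code `(i,j,k,l; cik, cil, cjk, cjl)` is based on the cover set `𝒜`. -/
def BasedOn (𝒜 : Set (LGraph L)) (i j k l : Fin m) (cik cil cjk cjl : ℕ) : Prop :=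
  ∃ A ∈ 𝒜, ∃ A' ∈ 𝒜,
    A.Covers i k cik ∧ A.Covers j k cjk ∧ A'.Covers i l cil ∧ A'.Covers j l cjl

/-- The code `(i,j,k,l; cik, cil, cjk, cjl)` is based on triangles from the cover set `𝒜`. -/
def BasedOnTriangles (𝒜 : Set (LGraph L)) (i j k l : Fin m) (cik cil cjk cjl : ℕ) : Prop :=
  ∃ A ∈ 𝒜, ∃ A' ∈ 𝒜, A.IsTriangle ∧ A'.IsTriangle ∧
    A.Covers i k cik ∧ A.Covers j k cjk ∧ A'.Covers i l cil ∧ A'.Covers j l cjl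

/-- The age of `G`: the class of finite `L`-graphs embedding into `G`. -/
def Age (G : LGraph L) : Set (LGraph L) := {A | Finite A.V ∧ G.Realized A}

/-- `Forb F`: the class of finite `L`-graphs into which no member of `F` embeds. -/
def Forb (F : Set (LGraph L)) : Set (LGraph L) :=
  {B | Finite B.V ∧ ∀ A ∈ F, ¬ B.Realized A}

/-- An amalgamation class: a class of finite `L`-graphs closed under isomorphism and
induced subgraphs with the amalgamation property. -/
def IsAmalgamationClass (𝒞 : Set (LGraph L)) : Prop :=
  (∀ A ∈ 𝒞, Finite A.V) ∧
  (∀ A ∈ 𝒞, ∀ B : LGraph L, A.IsIsomorphic B → B ∈ 𝒞) ∧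
  (∀ A ∈ 𝒞, ∀ S : Set A.V, A.restrict S ∈ 𝒞) ∧
  ∀ A B₁ B₂ : LGraph L, A ∈ 𝒞 → B₁ ∈ 𝒞 → B₂ ∈ 𝒞 →
    ∀ (f₁ : A.V → B₁.V) (f₂ : A.V → B₂.V),
      IsEmbedding A B₁ f₁ → IsEmbedding A B₂ f₂ →
      ∃ C ∈ 𝒞, ∃ (g₁ : B₁.V → C.V) (g₂ : B₂.V → C.V),
        IsEmbedding B₁ C g₁ ∧ IsEmbedding B₂ C g₂ ∧ g₁ ∘ f₁ = g₂ ∘ f₂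

section Parts01

variable [NeZero m]

/-- `A ≤₀₁ B`: `A` is an off-`E_{01}`-subgraph of `B`, i.e. `A` embeds into `B` ignoring
the colours of edges between `V_0` and `V_1` (equivalently, `A` embeds into the graph
obtained from `B` by recolouring its `E_{01}`-edge with the `E_{01}`-colour of `A`). -/
def Le01 (A B : LGraph L) : Prop :=
  ∃ f : A.V → B.V, Function.Injective f ∧ (∀ x, B.part (f x) = A.part x) ∧
    ∀ x y : A.V, A.part x ≠ A.part y →
      ¬((A.part x = 0 ∧ A.part y = 1) ∨ (A.part x = 1 ∧ A.part y = 0)) →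
      B.colour (f x) (f y) = A.colour x y

/-- `A` and `B` are off-`E_{01}`-isomorphic. -/
def OffIso01 (A B : LGraph L) : Prop := Le01 A B ∧ Le01 B A

/-- `A` is a maximal element of the quasi-order `(𝒜, ≤₀₁)`. -/
def MaxIn (𝒜 : Set (LGraph L)) (A : LGraph L) : Prop :=
  A ∈ 𝒜 ∧ ∀ B ∈ 𝒜, Le01 A B → Le01 B A

/-- `𝒜 ∈ Λ`: a `C_{01}`-cover set contained in `O(G)` of size exactly `|C_{01}|`. -/
def InLambda (G : LGraph L) (𝒜 : Set (LGraph L)) : Prop :=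
  (∀ A ∈ 𝒜, G.MinOmitted A) ∧ IsCoverSet 𝒜 0 1 ∧ 𝒜.ncard = (L.C 0 1).card

/-- The graph obtained from `A` by recolouring its `E_{01}`-edge with `α`
(that is, `A^{c/α}` where `c` is the `E_{01}`-colour of `A`) is realized in `G`. -/
def RealizedRecoloured01 (G A : LGraph L) (α : ℕ) : Prop :=
  ∃ f : A.V → G.V, Function.Injective f ∧ (∀ x, G.part (f x) = A.part x) ∧
    (∀ x y : A.V, A.part x ≠ A.part y →
      ¬((A.part x = 0 ∧ A.part y = 1) ∨ (A.part x = 1 ∧ A.part y = 0)) →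
      G.colour (f x) (f y) = A.colour x y) ∧
    ∀ x y : A.V, A.part x = 0 → A.part y = 1 → G.colour (f x) (f y) = α

/-- `Ω₀₁(𝒜) ⊆ Ω₀₁(ℬ)`: every code `(0,1,k,l; c_{0k}, c_{0l}, c_{1k}, c_{1l})`
based on `𝒜` is based on `ℬ`. -/
def Omega01Le (𝒜 ℬ : Set (LGraph L)) : Prop :=
  ∀ k l : Fin m, k ≠ l → k ≠ 0 → k ≠ 1 → l ≠ 0 → l ≠ 1 →
    ∀ c0k c0l c1k c1l : ℕ,
      BasedOn 𝒜 0 1 k l c0k c0l c1k c1l → BasedOn ℬ 0 1 k l c0k c0l c1k c1l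

/-- `ℬ` is a good `C_{01}`-cover set (for `G`): there is a key colour `α ∈ C_{01}` with key
monic `A^α ∈ ℬ` such that every member of `ℬ`, after recolouring its `E_{01}`-edge by `α`,
is either an (off-`E_{01}`-)subgraph of `A^α` or realized in `G`. -/
def GoodCoverSet (G : LGraph L) (ℬ : Set (LGraph L)) : Prop :=
  ∃ α ∈ L.C 0 1, ∃ Aα ∈ ℬ, Aα.Covers 0 1 α ∧
    ∀ A ∈ ℬ, Le01 A Aα ∨ RealizedRecoloured01 G A α

/-- `ℬ` is a star `C_{01}`-cover set: good, with a key monic which either has vertices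
in at least four parts, or has vertices in exactly three parts `V_0, V_1, V_i` while no
other member of `ℬ` has vertices in all of the remaining parts. -/
def StarCoverSet (G : LGraph L) (ℬ : Set (LGraph L)) : Prop :=
  ∃ α ∈ L.C 0 1, ∃ Aα ∈ ℬ, Aα.Covers 0 1 α ∧
    (∀ A ∈ ℬ, Le01 A Aα ∨ RealizedRecoloured01 G A α) ∧
    (4 ≤ (Set.range Aα.part).ncard ∨
      ∃ i : Fin m, i ≠ 0 ∧ i ≠ 1 ∧ Set.range Aα.part = {0, 1, i} ∧
        ∀ B ∈ ℬ, B ≠ Aα → ∃ p : Fin m, p ≠ 0 ∧ p ≠ 1 ∧ p ≠ i ∧ p ∉ Set.range B.part)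

/-- `B` is a copy of the monic `B^{cd}` (relative to the background colours `α`): a monic
with exactly one vertex in every part, `E_{01}`-colour `c`, `E_{12}`-colour `d`, and
`E_{ij}`-colour `α i j` for every other pair of distinct parts. -/
def IsBcd (B : LGraph L) (α : Fin m → Fin m → ℕ) (c d : ℕ) : Prop :=
  B.Monic ∧ (∀ i : Fin m, ∃ x : B.V, B.part x = i) ∧
  (∀ x y : B.V, B.part x = 0 → B.part y = 1 → B.colour x y = c) ∧
  (∀ x y : B.V, B.part x = 1 → B.part y = 2 → B.colour x y = d) ∧
  (∀ x y : B.V, B.part x ≠ B.part y →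
    ¬((B.part x = 0 ∧ B.part y = 1) ∨ (B.part x = 1 ∧ B.part y = 0)) →
    ¬((B.part x = 1 ∧ B.part y = 2) ∨ (B.part x = 2 ∧ B.part y = 1)) →
    B.colour x y = α (B.part x) (B.part y))

end Parts01


structure AS (V Θ : Type) where
  τ : V → Θ
  c : V → V → ℕ
  symm : ∀ v w, c v w = c w v
  zero : ∀ v w, c v w = 0 ↔ v = w
  same : ∀ v w, τ v = τ w → v ≠ w → c v w = 1
  ext : ∀ (l : List (V × V)) (F : List V) (q : V), (∀ p ∈ l, τ p.1 = τ p.2) →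
    (∀ p ∈ l, ∀ p' ∈ l, c p.1 p'.1 = c p.2 p'.2) → (∀ p ∈ l, q ≠ p.1) →
    ∃ q', (∀ f ∈ F, q' ≠ f) ∧ τ q' = τ q ∧ ∀ p ∈ l, c q' p.2 = c q p.1

namespace AS

variable {V Θ : Type} (S : AS V Θ)

def R3 (a b d : Θ) (ab ad bd : ℕ) : Prop :=
  ∃ u v w, S.τ u = a ∧ S.τ v = b ∧ S.τ w = d ∧ S.c u v = ab ∧ S.c u w = ad ∧ S.c v w = bd ∧
    ab ≠ 0 ∧ ad ≠ 0 ∧ bd ≠ 0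

def R4 (a b d e : Θ) (ab ad ae bd be de : ℕ) : Prop :=
  ∃ u v w z, S.τ u = a ∧ S.τ v = b ∧ S.τ w = d ∧ S.τ z = e ∧
    S.c u v = ab ∧ S.c u w = ad ∧ S.c u z = ae ∧ S.c v w = bd ∧ S.c v z = be ∧ S.c w z = de ∧
    ab ≠ 0 ∧ ad ≠ 0 ∧ ae ≠ 0 ∧ bd ≠ 0 ∧ be ≠ 0 ∧ de ≠ 0

variable {S}

theorem R3.s12 {a b d : Θ} {ab ad bd : ℕ} (h : S.R3 a b d ab ad bd) : S.R3 b a d ab bd ad := by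
  obtain ⟨u, v, w, h⟩ := h
  exact ⟨v, u, w, by grind [S.symm]⟩

theorem R3.s23 {a b d : Θ} {ab ad bd : ℕ} (h : S.R3 a b d ab ad bd) : S.R3 a d b ad ab bd := by
  obtain ⟨u, v, w, h⟩ := h
  exact ⟨u, w, v, by grind [S.symm]⟩

theorem R4.s12 {a b d e : Θ} {ab ad ae bd be de : ℕ} (h : S.R4 a b d e ab ad ae bd be de) :
    S.R4 b a d e ab bd be ad ae de := by
  obtain ⟨u, v, w, z, h⟩ := h
  exact ⟨v, u, w, z, by grind [S.symm]⟩

theorem R4.s23 {a b d e : Θ} {ab ad ae bd be de : ℕ} (h : S.R4 a b d e ab ad ae bd be de) :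
    S.R4 a d b e ad ab ae bd de be := by
  obtain ⟨u, v, w, z, h⟩ := h
  exact ⟨u, w, v, z, by grind [S.symm]⟩

theorem R4.s34 {a b d e : Θ} {ab ad ae bd be de : ℕ} (h : S.R4 a b d e ab ad ae bd be de) :
    S.R4 a b e d ab ae ad be bd de := by
  obtain ⟨u, v, w, z, h⟩ := h
  exact ⟨u, v, z, w, by grind [S.symm]⟩

theorem R4.to3 {a b d e : Θ} {ab ad ae bd be de : ℕ} (h : S.R4 a b d e ab ad ae bd be de) :
    S.R3 a b d ab ad bd := by
  obtain ⟨u, v, w, z, h⟩ := h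
  exact ⟨u, v, w, by grind⟩

theorem self0 (v : V) : S.c v v = 0 := (S.zero v v).2 rfl

theorem ext2 (a b a' b' q : V) (F : List V) (ha : S.τ a = S.τ a') (hb : S.τ b = S.τ b')
    (hab : S.c a b = S.c a' b') (qa : S.c q a ≠ 0) (qb : S.c q b ≠ 0) :
    ∃ q', (∀ f ∈ F, S.c q' f ≠ 0) ∧ S.τ q' = S.τ q ∧ S.c q' a' = S.c q a ∧
      S.c q' b' = S.c q b := by
  have := S.ext [(a, a'), (b, b')] F q (by simp [ha, hb])
    (by simp [self0, hab, S.symm b a, S.symm b' a'])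
    (by simp; rw [← S.zero, ← S.zero]; simp [qa, qb])
  obtain ⟨q', h1, h2, h3⟩ := this
  refine ⟨q', fun f hf h => h1 f hf ((S.zero _ _).1 h), h2, ?_⟩
  simpa using h3

theorem ext3 (a b d a' b' d' q : V) (F : List V) (ha : S.τ a = S.τ a') (hb : S.τ b = S.τ b')
    (hd : S.τ d = S.τ d')
    (hab : S.c a b = S.c a' b') (had : S.c a d = S.c a' d') (hbd : S.c b d = S.c b' d')
    (qa : S.c q a ≠ 0) (qb : S.c q b ≠ 0) (qd : S.c q d ≠ 0) :
    ∃ q', (∀ f ∈ F, S.c q' f ≠ 0) ∧ S.τ q' = S.τ q ∧ S.c q' a' = S.c q a ∧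
      S.c q' b' = S.c q b ∧ S.c q' d' = S.c q d := by
  have := S.ext [(a, a'), (b, b'), (d, d')] F q (by simp [ha, hb, hd])
    (by simp [self0, hab, S.symm b a, S.symm b' a', had, hbd, S.symm d a, S.symm d' a',
          S.symm d b, S.symm d' b'])
    (by simp; rw [← S.zero, ← S.zero, ← S.zero]; simp [qa, qb, qd])
  obtain ⟨q', h1, h2, h3⟩ := this
  refine ⟨q', fun f hf h => h1 f hf ((S.zero _ _).1 h), h2, ?_⟩
  simpa using h3

theorem ext4 (a b d e a' b' d' e' q : V) (F : List V) (ha : S.τ a = S.τ a') (hb : S.τ b = S.τ b')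
    (hd : S.τ d = S.τ d') (he : S.τ e = S.τ e')
    (hab : S.c a b = S.c a' b') (had : S.c a d = S.c a' d') (hae : S.c a e = S.c a' e')
    (hbd : S.c b d = S.c b' d') (hbe : S.c b e = S.c b' e') (hde : S.c d e = S.c d' e')
    (qa : S.c q a ≠ 0) (qb : S.c q b ≠ 0) (qd : S.c q d ≠ 0) (qe : S.c q e ≠ 0) :
    ∃ q', (∀ f ∈ F, S.c q' f ≠ 0) ∧ S.τ q' = S.τ q ∧ S.c q' a' = S.c q a ∧
      S.c q' b' = S.c q b ∧ S.c q' d' = S.c q d ∧ S.c q' e' = S.c q e := by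
  have := S.ext [(a, a'), (b, b'), (d, d'), (e, e')] F q (by simp [ha, hb, hd, he])
    (by simp [self0, hab, S.symm b a, S.symm b' a', had, hbd, S.symm d a, S.symm d' a',
          S.symm d b, S.symm d' b', hae, hbe, hde, S.symm e a, S.symm e' a', S.symm e b,
          S.symm e' b', S.symm e d, S.symm e' d'])
    (by simp; rw [← S.zero, ← S.zero, ← S.zero, ← S.zero]; simp [qa, qb, qd, qe])
  obtain ⟨q', h1, h2, h3⟩ := this
  refine ⟨q', fun f hf h => h1 f hf ((S.zero _ _).1 h), h2, ?_⟩
  simpa using h3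

theorem same' {v w : V} (h : S.τ v = S.τ w) (h0 : S.c v w ≠ 0) : S.c v w = 1 :=
  S.same v w h (fun e => h0 ((S.zero _ _).2 e))

/-- Key lemma. -/
theorem keyL (p q r s t : Θ) (pr ps pt qr qs qt rs st e e' : ℕ)
    (h1 : S.R4 p r s t pr ps pt rs e st) (h2 : S.R3 q r t qr qt e)
    (h3 : S.R4 q r s t qr qs qt rs e' st) (h4 : S.R3 p r t pr pt e') :
    ∃ f, S.R4 p r s t pr ps pt rs f st ∧ S.R4 q r s t qr qs qt rs f st := by
  have sy := S.symm
  obtain ⟨P, R, S1, T, h1⟩ := h1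
  obtain ⟨P4, R4, T4, h4⟩ := h4
  obtain ⟨T', hT'⟩ := ext2 (S := S) P4 R4 P R T4 [T] (by grind) (by grind) (by grind) (by grind)
    (by grind)
  have hTT : S.c T' T = 1 := same' (by grind) (hT'.1 T (by simp))
  obtain ⟨Q2, R2, T2, h2⟩ := h2
  obtain ⟨Q3, R3, S3, T3, h3⟩ := h3
  obtain ⟨T3', hT3'⟩ := ext2 (S := S) Q3 R3 Q2 R2 T3 [T2] (by grind) (by grind) (by grind)
    (by grind) (by grind)
  have hTT3 : S.c T3' T2 = 1 := same' (by grind) (hT3'.1 T2 (by simp))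
  obtain ⟨Q, hQ⟩ := ext3 (S := S) R2 T2 T3' R T T' Q2 [P, S1] (by grind) (by grind) (by grind)
    (by grind) (by grind) (by grind) (by grind) (by grind) (by grind)
  have hQP := hQ.1 P (by simp)
  have hQS := hQ.1 S1 (by simp)
  obtain ⟨S', hS'⟩ := ext3 (S := S) Q3 R3 T3 Q R T' S3 [P, S1, T] (by grind) (by grind) (by grind)
    (by grind) (by grind) (by grind) (by grind) (by grind) (by grind)
  have hS'P := hS'.1 P (by simp)
  have hS'S := hS'.1 S1 (by simp)
  have hSS : S.c S' S1 = 1 := same' (by grind) hS'S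
  obtain ⟨S2, hS2⟩ := ext3 (S := S) P Q T' P Q T S' [S1] (by grind) (by grind) (by grind)
    (by grind) (by grind) (by grind) (by grind) (by grind) (by grind)
  have hSS2 : S.c S2 S1 = 1 := same' (by grind) (hS2.1 S1 (by simp))
  obtain ⟨T5, hT5⟩ := ext4 (S := S) P Q S1 S2 P Q S1 S' T [R] (by grind) (by grind) (by grind)
    (by grind) (by grind) (by grind) (by grind) (by grind) (by grind) (by grind) (by grind)
    (by grind) (by grind) (by grind)
  have hT5R := hT5.1 R (by simp)
  refine ⟨S.c R T5, ⟨P, R, S1, T5, ?_⟩, ⟨Q, R, S', T5, ?_⟩⟩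
  · grind
  · grind

end AS

namespace AS
variable {V Θ : Type} {S : AS V Θ}

theorem amal (x y d s b : Θ) (xd xs xb yd ys yb ds db sb : ℕ)
    (h1 : S.R4 x d s b xd xs xb ds db sb) (h2 : S.R4 y d s b yd ys yb ds db sb) :
    ∃ X Y D S1 B, S.τ X = x ∧ S.τ Y = y ∧ S.τ D = d ∧ S.τ S1 = s ∧ S.τ B = b ∧
      S.c X D = xd ∧ S.c X S1 = xs ∧ S.c X B = xb ∧ S.c Y D = yd ∧ S.c Y S1 = ys ∧ S.c Y B = yb ∧
      S.c D S1 = ds ∧ S.c D B = db ∧ S.c S1 B = sb ∧ S.c X Y ≠ 0 := by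
  have sy := S.symm
  obtain ⟨X, D, S1, B, h1⟩ := h1
  obtain ⟨Y2, D2, S2, B2, h2⟩ := h2
  obtain ⟨Y, hY⟩ := ext3 (S := S) D2 S2 B2 D S1 B Y2 [X] (by grind) (by grind) (by grind)
    (by grind) (by grind) (by grind) (by grind) (by grind) (by grind)
  have := hY.1 X (by simp)
  exact ⟨X, Y, D, S1, B, by grind⟩

theorem R3.ne {a b d : Θ} {ab ad bd : ℕ} (h : S.R3 a b d ab ad bd) : ab ≠ 0 ∧ ad ≠ 0 ∧ bd ≠ 0 := by
  obtain ⟨u, v, w, h⟩ := h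
  grind

theorem R4.ne {a b d e : Θ} {ab ad ae bd be de : ℕ} (h : S.R4 a b d e ab ad ae bd be de) :
    ab ≠ 0 ∧ ad ≠ 0 ∧ ae ≠ 0 ∧ bd ≠ 0 ∧ be ≠ 0 ∧ de ≠ 0 := by
  obtain ⟨u, v, w, z, h⟩ := h
  grind

theorem goodY (x y d s b : Θ) (xd yd xs ys xb yb sb c0 k es : ℕ)
    (h1 : S.R4 x y d s c0 xd xs yd ys es) (h2 : S.R4 x y s b c0 k xb ys yb sb)
    (hk : S.R3 x d s xd k es) (h3 : S.R3 x s b xs xb sb) :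
    ∃ eb, S.R3 x d b xd xb eb ∧ S.R4 y d s b yd ys yb es eb sb := by
  obtain ⟨f, ha, hb⟩ := keyL (S := S) d b x y s xd yd es xb yb sb c0 ys xs k
    h1.s23.s12.s23.s23 h3.s23.s12 h2.s34.s23.s12 hk.s12
  have := ha.ne
  have := hb.ne
  obtain ⟨D, B, X, Y, S1, h⟩ := amal _ _ _ _ _ _ _ _ _ _ _ _ _ _ ha hb
  have sy := S.symm
  exact ⟨S.c D B, ⟨X, D, B, by grind⟩, ⟨Y, D, S1, B, by grind⟩⟩

theorem L2 (x y d s b : Θ) (xd yd xs ys xb yb sb c0 : ℕ)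
    (hd : S.R3 x y d c0 xd yd) (hs : S.R3 x y s c0 xs ys) (hb : S.R3 x y b c0 xb yb)
    (hx : S.R3 x s b xs xb sb) (hy : S.R3 y s b ys yb sb) :
    ∃ c, S.R3 x y d c xd yd ∧ S.R4 x y s b c xs xb ys yb sb := by
  have sy := S.symm
  have := hs.ne
  have := hb.ne
  have := hx.ne
  suffices H : ∃ k l es, S.R4 x y d s c0 xd xs yd ys es ∧ S.R4 x y s b c0 k xb ys yb sb ∧
      S.R3 x d s xd k es ∧ S.R4 x y s b c0 xs xb l yb sb ∧ S.R3 y d s yd l es by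
    obtain ⟨k, l, es, h1, h2, h3, h4, h5⟩ := H
    obtain ⟨e', g1, g2⟩ := goodY (S := S) _ _ _ _ _ _ _ _ _ _ _ _ _ _ _ h1 h2 h3 hx
    obtain ⟨e, g3, g4⟩ := goodY (S := S) _ _ _ _ _ _ _ _ _ _ _ _ _ _ _ h1.s12 h4.s12 h5 hy
    obtain ⟨f, ha, hb⟩ := keyL (S := S) _ _ _ _ _ _ _ _ _ _ _ _ _ _ _ g4 g3 g2 g1
    have := ha.ne
    have := hb.ne
    obtain ⟨X, Y, D, S1, B, h⟩ := amal _ _ _ _ _ _ _ _ _ _ _ _ _ _ ha hb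
    exact ⟨S.c X Y, ⟨X, Y, D, by grind⟩, ⟨X, Y, S1, B, by grind⟩⟩
  obtain ⟨x1, y1, b1, hb⟩ := hb
  obtain ⟨x2, s2, b2, hx⟩ := hx
  obtain ⟨s1, hs1⟩ := ext2 (S := S) x2 b2 x1 b1 s2 [y1] (by grind) (by grind) (by grind) (by grind)
    (by grind)
  have hsy1 := hs1.1 y1 (by simp)
  obtain ⟨y3, s3, b3, hy⟩ := hy
  obtain ⟨Y, hY⟩ := ext2 (S := S) s3 b3 s1 b1 y3 [y1] (by grind) (by grind) (by grind) (by grind)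
    (by grind)
  have hYy1 := same' (by grind) (hY.1 y1 (by simp))
  obtain ⟨y2, hy2⟩ := ext2 (S := S) x1 b1 x1 b1 y1 [y1] (by grind) (by grind) (by grind) (by grind)
    (by grind)
  have hy21 := same' (by grind) (hy2.1 y1 (by simp))
  obtain ⟨X, hX⟩ := ext3 (S := S) y2 y1 b1 Y y1 b1 x1 [s1] (by grind) (by grind) (by grind) (by grind)
    (by grind) (by grind) (by grind) (by grind) (by grind)
  have hXs := hX.1 s1 (by simp)
  obtain ⟨x4, y4, s4, hs⟩ := hs
  obtain ⟨y5, hy5⟩ := ext2 (S := S) x4 s4 x1 s1 y4 [y1] (by grind) (by grind) (by grind) (by grind)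
    (by grind)
  have hy51 := same' (by grind) (hy5.1 y1 (by simp))
  obtain ⟨X', hX'⟩ := ext3 (S := S) y5 y1 s1 Y y1 s1 x1 [X] (by grind) (by grind) (by grind)
    (by grind) (by grind) (by grind) (by grind) (by grind) (by grind)
  have hXX := same' (by grind) (hX'.1 X (by simp))
  obtain ⟨x6, y6, d6, hd⟩ := hd
  obtain ⟨y7, hy7⟩ := ext2 (S := S) x6 d6 x6 d6 y6 [y6] (by grind) (by grind) (by grind) (by grind)
    (by grind)
  have hy76 := same' (by grind) (hy7.1 y6 (by simp))
  obtain ⟨x7, hx7⟩ := ext3 (S := S) d6 y6 y7 d6 y6 y7 x6 [x6] (by grind) (by grind) (by grind)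
    (by grind) (by grind) (by grind) (by grind) (by grind) (by grind)
  have hx76 := same' (by grind) (hx7.1 x6 (by simp))
  obtain ⟨D, hD⟩ := ext4 (S := S) x6 x7 y6 y7 X X' Y y1 d6 [s1] (by grind) (by grind) (by grind)
    (by grind) (by grind) (by grind) (by grind) (by grind) (by grind) (by grind) (by grind)
    (by grind) (by grind) (by grind)
  have hDs := hD.1 s1 (by simp)
  refine ⟨S.c X s1, S.c y1 s1, S.c D s1, ⟨X', Y, D, s1, ?_⟩, ⟨X, Y, s1, b1, ?_⟩, ⟨X, D, s1, ?_⟩,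
    ⟨x1, y1, s1, b1, ?_⟩, ⟨y1, D, s1, ?_⟩⟩
  · grind
  · grind
  · grind
  · grind
  · grind
end AS

namespace AS
variable {V Θ : Type} {S : AS V Θ}

theorem L3a (x y z1 z2 z3 : Θ) (a1 a2 a3 b1 b2 b3 t12 t13 t23 : ℕ)
    (x12 : S.R3 x z1 z2 a1 a2 t12) (y12 : S.R3 y z1 z2 b1 b2 t12)
    (x13 : S.R3 x z1 z3 a1 a3 t13) (y13 : S.R3 y z1 z3 b1 b3 t13)
    (x23 : S.R3 x z2 z3 a2 a3 t23) (y23 : S.R3 y z2 z3 b2 b3 t23)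
    (h : S.R3 z1 z2 z3 t12 t13 t23) :
    ∃ c, S.R3 x y z1 c a1 b1 ∧ S.R3 x y z2 c a2 b2 ∧ S.R3 x y z3 c a3 b3 := by
  have sy := S.symm
  obtain ⟨e, g1, g2⟩ := L2 (S := S) z1 z2 y x z3 _ _ _ _ _ _ _ _ y12.s12.s23 x12.s12.s23 h
    x13.s12 x23.s12
  obtain ⟨e', g3, g4⟩ := L2 (S := S) z1 z2 x y z3 _ _ _ _ _ _ _ _ x12.s12.s23 y12.s12.s23 h
    y13.s12 y23.s12
  obtain ⟨f, ha, hb⟩ := keyL (S := S) x y z1 z3 z2 _ _ _ _ _ _ _ _ _ _ g2.s23.s12.s34 g1.s23.s12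
    g4.s23.s12.s34 g3.s23.s12
  have := ha.ne
  have := hb.ne
  obtain ⟨X, Y, Z1, Z3, Z2, h⟩ := amal _ _ _ _ _ _ _ _ _ _ _ _ _ _ ha hb
  exact ⟨S.c X Y, ⟨X, Y, Z1, by grind⟩, ⟨X, Y, Z2, by grind⟩, ⟨X, Y, Z3, by grind⟩⟩

theorem L3b (x y z1 z2 z3 : Θ) (a1 a2 a3 b1 b2 b3 t13 t23 c12 k : ℕ)
    (x13 : S.R3 x z1 z3 a1 a3 t13) (y13 : S.R3 y z1 z3 b1 b3 t13)
    (x23 : S.R3 x z2 z3 a2 a3 t23) (y23 : S.R3 y z2 z3 b2 b3 t23)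
    (h1 : S.R3 x y z1 c12 a1 b1) (h2 : S.R3 x y z2 c12 a2 b2)
    (h3 : S.R3 x y z3 c12 k b3) (k1 : S.R3 x z1 z3 a1 k t13) (k2 : S.R3 x z2 z3 a2 k t23) :
    ∃ c, S.R3 x y z1 c a1 b1 ∧ S.R3 x y z2 c a2 b2 ∧ S.R3 x y z3 c a3 b3 := by
  have sy := S.symm
  obtain ⟨e, g1, g2⟩ := L2 (S := S) x z3 z2 y z1 _ _ _ _ _ _ _ _ k2.s23 h3.s23 k1.s23
    h1 y13.s23.s12
  obtain ⟨e', g3, g4⟩ := L2 (S := S) x z3 z1 y z2 _ _ _ _ _ _ _ _ k1.s23 h3.s23 k2.s23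
    h2 y23.s23.s12
  obtain ⟨f, ha, hb⟩ := keyL (S := S) z1 z2 x y z3 _ _ _ _ _ _ _ _ _ _ g2.s23.s34.s23.s12
    g1.s23.s12
    g4.s23.s34.s23.s12 g3.s23.s12
  have := ha.ne
  have := hb.ne
  obtain ⟨Z1, Z2, X, Y, Z3, h⟩ := amal _ _ _ _ _ _ _ _ _ _ _ _ _ _ ha hb
  exact L3a x y z1 z2 z3 a1 a2 a3 b1 b2 b3 (S.c Z1 Z2) t13 t23 ⟨X, Z1, Z2, by grind⟩
    ⟨Y, Z1, Z2, by grind⟩ x13 y13 x23 y23 ⟨Z1, Z2, Z3, by grind⟩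

theorem L3c (x y z1 z3 : Θ) (a1 a3 b1 b3 c12 c13 k : ℕ)
    (h1 : S.R3 x y z1 c12 a1 b1) (h2 : S.R3 x y z1 c13 a1 b1) (h3 : S.R3 x y z3 c13 a3 b3)
    (h4 : S.R3 x y z3 c12 k b3) :
    ∃ t, S.R3 x z1 z3 a1 a3 t ∧ S.R3 y z1 z3 b1 b3 t ∧ S.R3 x z1 z3 a1 k t := by
  have sy := S.symm
  obtain ⟨X, Y, Z3, h4⟩ := h4
  obtain ⟨x3, y3, w3, h3⟩ := h3
  obtain ⟨X', hX'⟩ := ext2 (S := S) y3 w3 Y Z3 x3 [X] (by grind) (by grind) (by grind) (by grind)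
    (by grind)
  have hXX := same' (by grind) (hX'.1 X (by simp))
  obtain ⟨x1, y1, w1, h1⟩ := h1
  obtain ⟨x2, y2, w2, h2⟩ := h2
  obtain ⟨x5, hx5⟩ := ext2 (S := S) y2 w2 y1 w1 x2 [x1] (by grind) (by grind) (by grind) (by grind)
    (by grind)
  have hxx := same' (by grind) (hx5.1 x1 (by simp))
  obtain ⟨Z1, hZ1⟩ := ext3 (S := S) x1 x5 y1 X X' Y w1 [Z3] (by grind) (by grind) (by grind)
    (by grind) (by grind) (by grind) (by grind) (by grind) (by grind)
  have := hZ1.1 Z3 (by simp)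
  refine ⟨S.c Z1 Z3, ⟨X', Z1, Z3, ?_⟩, ⟨Y, Z1, Z3, ?_⟩, ⟨X, Z1, Z3, ?_⟩⟩
  · grind
  · grind
  · grind

theorem L3d (x y z1 z3 : Θ) (a1 a3 b1 b3 c12 c13 : ℕ)
    (h1 : S.R3 x y z1 c12 a1 b1) (h3 : S.R3 x y z3 c13 a3 b3) :
    ∃ k, S.R3 x y z3 c12 k b3 := by
  have sy := S.symm
  obtain ⟨X, Y, Z1, h1⟩ := h1
  obtain ⟨x3, y3, w3, h3⟩ := h3
  obtain ⟨Z3, hZ3⟩ := ext2 (S := S) y3 y3 Y Y w3 [X] (by grind) (by grind) (by grind [S.self0])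
    (by grind) (by grind)
  have := hZ3.1 X (by simp)
  exact ⟨S.c X Z3, X, Y, Z3, by grind⟩

theorem L3 (x y z1 z2 z3 : Θ) (a1 a2 a3 b1 b2 b3 c12 c13 c23 : ℕ)
    (h121 : S.R3 x y z1 c12 a1 b1) (h122 : S.R3 x y z2 c12 a2 b2)
    (h131 : S.R3 x y z1 c13 a1 b1) (h133 : S.R3 x y z3 c13 a3 b3)
    (h232 : S.R3 x y z2 c23 a2 b2) (h233 : S.R3 x y z3 c23 a3 b3) :
    ∃ c, S.R3 x y z1 c a1 b1 ∧ S.R3 x y z2 c a2 b2 ∧ S.R3 x y z3 c a3 b3 := by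
  obtain ⟨k, hk⟩ := L3d _ _ _ _ _ _ _ _ _ _ h121 h133
  obtain ⟨t13, p1, p2, p3⟩ := L3c _ _ _ _ _ _ _ _ _ _ _ h121 h131 h133 hk
  obtain ⟨t23, q1, q2, q3⟩ := L3c _ _ _ _ _ _ _ _ _ _ _ h122 h232 h233 hk
  exact L3b _ _ _ _ _ _ _ _ _ _ _ _ _ _ _ p1 p2 q1 q2 h121 h122 hk p3 q3

theorem R4.to3x {x y s b : Θ} {c xs xb ys yb sb : ℕ} (h : S.R4 x y s b c xs xb ys yb sb) :
    S.R3 x y s c xs ys ∧ S.R3 x y b c xb yb ∧ S.R3 x s b xs xb sb ∧ S.R3 y s b ys yb sb :=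
  ⟨h.to3, h.s34.to3, h.s23.s34.to3, h.s12.s23.s34.to3⟩

theorem L2' (x y d s b : Θ) (xd yd xs ys xb yb sb c1 c2 c3 : ℕ)
    (h1 : S.R3 x y d c1 xd yd) (h2 : S.R3 x y s c1 xs ys)
    (h3 : S.R3 x y d c2 xd yd) (h4 : S.R3 x y b c2 xb yb)
    (h : S.R4 x y s b c3 xs xb ys yb sb) :
    ∃ c, S.R3 x y d c xd yd ∧ S.R4 x y s b c xs xb ys yb sb := by
  obtain ⟨g1, g2, g3, g4⟩ := h.to3x
  obtain ⟨c, k1, k2, k3⟩ := L3 _ _ _ _ _ _ _ _ _ _ _ _ _ _ h1 h2 h3 h4 g1 g2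
  exact L2 _ _ _ _ _ _ _ _ _ _ _ _ _ k1 k2 k3 g3 g4

/-- base change -/
theorem BC (x y u z w : Θ) (xu yu xz yz xw yw uz uw c1 c2 c3 d1 d2 : ℕ)
    (h1 : S.R3 x y u c1 xu yu) (h2 : S.R3 x y z c1 xz yz)
    (h3 : S.R3 x y u c2 xu yu) (h4 : S.R3 x y w c2 xw yw)
    (h5 : S.R3 x y z c3 xz yz) (h6 : S.R3 x y w c3 xw yw)
    (h7 : S.R4 x y u z d1 xu xz yu yz uz) (h8 : S.R4 x y u w d2 xu xw yu yw uw) :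
    ∃ c, S.R4 x y u z c xu xz yu yz uz ∧ S.R4 x y u w c xu xw yu yw uw := by
  obtain ⟨e, g1, g2⟩ := L2' _ _ _ _ _ _ _ _ _ _ _ _ _ _ _ h4 h3 h6 h5 h7
  obtain ⟨e', g3, g4⟩ := L2' _ _ _ _ _ _ _ _ _ _ _ _ _ _ _ h2 h1 h5 h6 h8
  obtain ⟨f, ha, hb⟩ := keyL (S := S) z w x u y _ _ _ _ _ _ _ _ _ _
    g2.s23.s34.s23.s12 g1.s23.s12 g4.s23.s34.s23.s12 g3.s23.s12
  exact ⟨f, ha.s12.s23.s34.s23, hb.s12.s23.s34.s23⟩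
end AS

namespace AS
variable {V Θ : Type} {S : AS V Θ}

/-- The structure over a base point `u`. -/
def base (S : AS V Θ) (u : V) : AS {v : V // v ≠ u} (Θ × ℕ) where
  τ v := (S.τ v.1, S.c v.1 u)
  c v w := S.c v.1 w.1
  symm v w := S.symm _ _
  zero v w := by rw [S.zero, Subtype.ext_iff]
  same v w h hn := S.same _ _ (Prod.ext_iff.1 h).1 (fun e => hn (Subtype.ext e))
  ext l F q h1 h2 h3 := by
    obtain ⟨q', g1, g2, g3⟩ := S.ext ((u, u) :: l.map (fun p => (p.1.1, p.2.1))) (u :: F.map (·.1)) q.1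
      (by
        intro p hp
        rcases List.mem_cons.1 hp with rfl | hp
        · rfl
        · obtain ⟨r, hr, rfl⟩ := List.mem_map.1 hp
          exact (Prod.ext_iff.1 (h1 r hr)).1)
      (by
        have key : ∀ p ∈ l, S.c p.1.1 u = S.c p.2.1 u := fun p hp => (Prod.ext_iff.1 (h1 p hp)).2
        intro p hp p' hp'
        rcases List.mem_cons.1 hp with rfl | hp
        · rcases List.mem_cons.1 hp' with rfl | hp'
          · rfl
          · obtain ⟨r', hr', rfl⟩ := List.mem_map.1 hp'
            have := key r' hr'
            simpa [S.symm u] using this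
        · obtain ⟨r, hr, rfl⟩ := List.mem_map.1 hp
          rcases List.mem_cons.1 hp' with rfl | hp'
          · exact key r hr
          · obtain ⟨r', hr', rfl⟩ := List.mem_map.1 hp'
            exact h2 r hr r' hr')
      (by
        intro p hp
        rcases List.mem_cons.1 hp with rfl | hp
        · exact q.2
        · obtain ⟨r, hr, rfl⟩ := List.mem_map.1 hp
          exact fun e => h3 r hr (Subtype.ext e))
    refine ⟨⟨q', g1 u (by simp)⟩, fun f hf e => g1 f.1 ?_ ?_, ?_, fun p hp => ?_⟩
    · exact List.mem_cons_of_mem _ (List.mem_map_of_mem hf)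
    · rw [← e]
    · exact Prod.ext g2 (g3 (u, u) (by simp))
    · exact g3 (p.1.1, p.2.1) (List.mem_cons_of_mem _ (List.mem_map.2 ⟨p, hp, rfl⟩))

theorem base_R3 (u : V) {a b d : Θ} {ab au ad bu bd ud : ℕ}
    (h : S.R4 a b (S.τ u) d ab au ad bu bd ud) :
    (S.base u).R3 (a, au) (b, bu) (d, ud) ab ad bd := by
  have sy := S.symm
  obtain ⟨x0, y0, u0, z0, h⟩ := h
  obtain ⟨X, hX⟩ := ext2 (S := S) u0 u0 u u x0 [] (by grind) (by grind) (by grind [S.self0])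
    (by grind) (by grind)
  obtain ⟨Y, hY⟩ := ext2 (S := S) u0 x0 u X y0 [] (by grind) (by grind) (by grind)
    (by grind) (by grind)
  obtain ⟨Z, hZ⟩ := ext3 (S := S) u0 x0 y0 u X Y z0 [] (by grind) (by grind) (by grind)
    (by grind) (by grind) (by grind) (by grind) (by grind) (by grind)
  have z := S.self0 u
  refine ⟨⟨X, by grind⟩, ⟨Y, by grind⟩, ⟨Z, by grind⟩, ?_⟩
  simp only [base, Prod.mk.injEq]
  grind

theorem of_base_R3 (u : V) {a b d : Θ × ℕ} {ab ad bd : ℕ}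
    (h : (S.base u).R3 a b d ab ad bd) : S.R3 a.1 b.1 d.1 ab ad bd := by
  obtain ⟨x, y, z, h⟩ := h
  simp only [base] at h
  exact ⟨x, y, z, by grind⟩

/-- `c` is a possible colour of `xy` over `l`. -/
def Tm (S : AS V Θ) (x y : V) (l : List V) (c : ℕ) : Prop :=
  c ≠ 0 ∧ ∃ x' y', S.τ x' = S.τ x ∧ S.τ y' = S.τ y ∧ S.c x' y' = c ∧
    ∀ v ∈ l, S.c x' v = S.c x v ∧ S.c y' v = S.c y v

def Q (S : AS V Θ) (x y z : V) (c : ℕ) : Prop :=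
  S.R3 (S.τ x) (S.τ y) (S.τ z) c (S.c x z) (S.c y z)

theorem of_base_Tm (u : V) {x y : {v // v ≠ u}} {l : List {v // v ≠ u}} {c : ℕ}
    (h : (S.base u).Tm x y l c) : S.Tm x.1 y.1 (u :: l.map (·.1)) c := by
  obtain ⟨h0, x', y', h1, h2, h3, h4⟩ := h
  simp only [base, Prod.mk.injEq] at h1 h2 h3 h4
  refine ⟨h0, x', y', h1.1, h2.1, h3, ?_⟩
  intro v hv
  rcases List.mem_cons.1 hv with rfl | hv
  · exact ⟨h1.2, h2.2⟩
  · obtain ⟨w, hw, rfl⟩ := List.mem_map.1 hv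
    exact h4 w hw

theorem Q_self {x y z : V} (h1 : x ≠ y) (h2 : x ≠ z) (h3 : y ≠ z) : S.Q x y z (S.c x y) := by
  have := S.zero
  exact ⟨x, y, z, by grind⟩

theorem R4_self {x y z w : V} (h1 : x ≠ y) (h2 : x ≠ z) (h3 : y ≠ z) (h4 : x ≠ w) (h5 : y ≠ w)
    (h6 : z ≠ w) : S.R4 (S.τ x) (S.τ y) (S.τ z) (S.τ w) (S.c x y) (S.c x z) (S.c x w)
      (S.c y z) (S.c y w) (S.c z w) := by
  have := S.zero
  exact ⟨x, y, z, w, by grind⟩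

theorem Q_move {x y z : V} {c : ℕ} (h : S.Q x y z c) :
    ∃ X Y, S.τ X = S.τ x ∧ S.τ Y = S.τ y ∧ S.c X z = S.c x z ∧ S.c Y z = S.c y z ∧
      S.c X Y = c ∧ X ≠ Y ∧ X ≠ z ∧ Y ≠ z := by
  have sy := S.symm
  have := h.ne
  have z0 := S.zero
  obtain ⟨x0, y0, u0, h⟩ := h
  obtain ⟨X, hX⟩ := ext2 (S := S) u0 u0 z z x0 [] (by grind) (by grind) (by grind [S.self0])
    (by grind) (by grind)
  obtain ⟨Y, hY⟩ := ext2 (S := S) u0 x0 z X y0 [] (by grind) (by grind) (by grind)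
    (by grind) (by grind)
  exact ⟨X, Y, by grind⟩

theorem BCQ {u x y x1 y1 z x2 y2 w : V} {c1 c2 c3 : ℕ}
    (hx1 : S.τ x1 = S.τ x) (hy1 : S.τ y1 = S.τ y) (hxu1 : S.c x1 u = S.c x u)
    (hyu1 : S.c y1 u = S.c y u)
    (hx2 : S.τ x2 = S.τ x) (hy2 : S.τ y2 = S.τ y) (hxu2 : S.c x2 u = S.c x u)
    (hyu2 : S.c y2 u = S.c y u)
    (h1 : S.Q x y u c1) (h2 : S.Q x1 y1 z c1) (h3 : S.Q x y u c2) (h4 : S.Q x2 y2 w c2)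
    (h5 : S.Q x1 y1 z c3) (h6 : S.Q x2 y2 w c3)
    (d1 : [u, x1, y1, z].Nodup) (d2 : [u, x2, y2, w].Nodup)
    (ux1 : x1 ≠ u) (uy1 : y1 ≠ u) (uz : z ≠ u) (ux2 : x2 ≠ u) (uy2 : y2 ≠ u) (uw : w ≠ u) :
    ∃ c, (S.base u).Q ⟨x1, ux1⟩ ⟨y1, uy1⟩ ⟨z, uz⟩ c ∧ (S.base u).Q ⟨x2, ux2⟩ ⟨y2, uy2⟩ ⟨w, uw⟩ c := by
  simp at d1 d2
  have g1 := R4_self (S := S) (x := x1) (y := y1) (z := u) (w := z) (by grind) (by grind) (by grind)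
    (by grind) (by grind) (by grind)
  have g2 := R4_self (S := S) (x := x2) (y := y2) (z := u) (w := w) (by grind) (by grind) (by grind)
    (by grind) (by grind) (by grind)
  unfold Q at *
  rw [hx1, hy1] at h2 h5 g1
  rw [hx2, hy2] at h4 h6 g2
  rw [hxu1, hyu1] at g1
  rw [hxu2, hyu2] at g2
  obtain ⟨c, k1, k2⟩ := BC _ _ _ _ _ _ _ _ _ _ _ _ _ _ _ _ _ _ h1 h2 h3 h4 h5 h6 g1 g2
  have k1 := base_R3 u k1
  have k2 := base_R3 u k2
  refine ⟨c, ?_, ?_⟩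
  · simp only [base, hx1, hy1, hxu1, hyu1, S.symm z u]
    exact k1
  · simp only [base, hx2, hy2, hxu2, hyu2, S.symm w u]
    exact k2

end AS

namespace AS

theorem attach_map {V : Type} {P : V → Prop} (l : List V) (h : ∀ v ∈ l, P v) :
    (l.attachWith P h).map (·.1) = l := by
  simp

theorem claim1 (n : ℕ) : ∀ {V Θ : Type} (S : AS V Θ) (x0 y0 u x y : V) (l : List V), l.length = n →
    S.τ x0 = S.τ x → S.τ y0 = S.τ y → x0 ≠ y0 → x0 ≠ u → y0 ≠ u → (x :: y :: l).Nodup →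
    (∀ z ∈ l, ∃ c, S.Q x0 y0 u c ∧ S.Q x y z c) → ∃ c, S.Q x0 y0 u c ∧ S.Tm x y l c := by
  induction n with
  | zero =>
    intro V Θ S x0 y0 u x y l hl hx hy h1 h2 h3 _ _
    have : l = [] := List.length_eq_zero_iff.1 hl
    subst this
    refine ⟨_, Q_self h1 h2 h3, ?_, x0, y0, hx, hy, rfl, by simp⟩
    have := S.zero
    grind
  | succ n ih =>
    intro V Θ S x0 y0 u x y l hl hx hy h1 h2 h3 hd hq
    have sy := S.symm
    have z0 := S.zero
    obtain _ | ⟨s, l⟩ := l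
    · simp at hl
    obtain ⟨c, q1, q2⟩ := hq s (by simp)
    obtain ⟨X, Y, g1, g2, g3, g4, g5, g6, g7, g8⟩ := Q_move q2
    have q1' := q1
    obtain ⟨x1, y1, u1, q1'⟩ := q1'
    obtain ⟨U, hU⟩ := ext2 (S := S) x1 y1 X Y u1 [s] (by grind) (by grind) (by grind) (by grind)
      (by grind)
    have hUs := hU.1 s (by simp)
    have hQ : ∀ d, S.Q X Y U d ↔ S.Q x0 y0 u d := by
      intro d
      unfold Q
      have e1 : S.τ X = S.τ x0 := by grind
      have e2 : S.τ Y = S.τ y0 := by grind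
      have e3 : S.τ U = S.τ u := by grind
      have e4 : S.c X U = S.c x0 u := by grind
      have e5 : S.c Y U = S.c y0 u := by grind
      rw [e1, e2, e3, e4, e5]
    have hUX : U ≠ X := by grind
    have hUY : U ≠ Y := by grind
    have hUs' : U ≠ s := by grind
    simp only [List.nodup_cons, List.mem_cons, not_or] at hd
    obtain ⟨⟨hd1, hd2, hd3⟩, ⟨hd4, hd5⟩, hd6, hd7⟩ := hd
    have hls : ∀ v ∈ l, v ≠ s := fun v hv e => hd6 (e ▸ hv)
    obtain ⟨c', k1, k2⟩ := ih (S.base s) ⟨X, g7⟩ ⟨Y, g8⟩ ⟨U, hUs'⟩ ⟨x, hd2⟩ ⟨y, hd4⟩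
      (l.attachWith _ hls) (by simpa using hl) (by simp [base, g1, g3]) (by simp [base, g2, g4])
      (by simpa using g6) (by simpa using hUX.symm) (by simpa using hUY.symm)
      (by
        rw [← List.nodup_map_iff Subtype.val_injective]
        simp only [List.map_cons, attach_map]
        simp [hd1, hd3, hd5, hd7])
      (by
        rintro ⟨w, hws⟩ hw
        have hw : w ∈ l := by simpa [List.mem_attachWith] using hw
        obtain ⟨c3, e1, e2⟩ := hq w (by simp [hw])
        refine BCQ (u := s) (x := x) (y := y) (c1 := c) (c2 := S.c x y) (c3 := c3) g1 g2 g3 g4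
          rfl rfl rfl rfl q2 ((hQ _).2 q1) (Q_self hd1 hd2 hd4)
          (Q_self hd1 (fun e => hd3 (e ▸ hw)) (fun e => hd5 (e ▸ hw))) ((hQ _).2 e1) e2 ?_ ?_ _ _ _ _ _ _
        · simp; grind
        · simp; grind)
    refine ⟨c', (hQ _).1 (of_base_R3 s k1), ?_⟩
    have := of_base_Tm s k2
    simpa only [attach_map] using this

variable {V Θ : Type} {S : AS V Θ}

theorem copy (l : List V) : ∀ (L : List (V × V)) (F : List V), (∀ p ∈ L, S.τ p.1 = S.τ p.2) →
    (∀ p ∈ L, ∀ p' ∈ L, S.c p.1 p'.1 = S.c p.2 p'.2) → l.Nodup → (∀ v ∈ l, ∀ p ∈ L, v ≠ p.1) →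
    ∃ f : V → V, ∀ v ∈ l, S.τ (f v) = S.τ v ∧ f v ∉ F ∧ (∀ p ∈ L, S.c (f v) p.2 = S.c v p.1) ∧
      ∀ w ∈ l, S.c (f v) (f w) = S.c v w := by
  classical
  induction l with
  | nil => intro L F _ _ _ _; exact ⟨id, by simp⟩
  | cons q l ih =>
    intro L F h1 h2 hn h3
    obtain ⟨q', g1, g2, g3⟩ := S.ext L F q h1 h2 (h3 q (by simp))
    rw [List.nodup_cons] at hn
    obtain ⟨f, hf⟩ := ih ((q, q') :: L) F
      (by
        intro p hp
        rcases List.mem_cons.1 hp with rfl | hp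
        · exact g2.symm
        · exact h1 p hp)
      (by
        intro p hp p' hp'
        have := S.self0
        have := S.symm
        rcases List.mem_cons.1 hp with rfl | hp <;> rcases List.mem_cons.1 hp' with rfl | hp'
        · simp [S.self0]
        · exact (g3 p' hp').symm
        · simp only; rw [S.symm, S.symm p.2]; exact (g3 p hp).symm
        · exact h2 p hp p' hp') hn.2
      (by
        intro v hv p hp
        rcases List.mem_cons.1 hp with rfl | hp
        · exact fun e => hn.1 ((show v = q from e) ▸ hv)
        · exact h3 v (by simp [hv]) p hp)
    have hne : ∀ v ∈ l, v ≠ q := fun v hv e => hn.1 (e ▸ hv)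
    refine ⟨fun v => if v = q then q' else f v, ?_⟩
    intro v hv
    rcases List.mem_cons.1 hv with rfl | hv
    · simp only [if_true]
      refine ⟨g2, fun e => g1 _ e rfl, g3, ?_⟩
      intro w hw
      rcases List.mem_cons.1 hw with rfl | hw
      · simp [S.self0]
      · rw [if_neg (hne w hw), S.symm, S.symm v]
        exact (hf w hw).2.2.1 (v, q') (by simp)
    · simp only [if_neg (hne v hv)]
      obtain ⟨k1, k2, k3, k4⟩ := hf v hv
      refine ⟨k1, k2, fun p hp => k3 p (by simp [hp]), ?_⟩
      intro w hw
      rcases List.mem_cons.1 hw with rfl | hw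
      · simp only [if_true]
        exact k3 (w, q') (by simp)
      · rw [if_neg (hne w hw)]
        exact k4 w hw

theorem Tm_transfer {x y X Y : V} {l : List V} {f : V → V} {c : ℕ}
    (hX : S.τ X = S.τ x) (hY : S.τ Y = S.τ y) (hf : ∀ v ∈ l, S.τ (f v) = S.τ v)
    (hXf : ∀ v ∈ l, S.c X (f v) = S.c x v) (hYf : ∀ v ∈ l, S.c Y (f v) = S.c y v)
    (hff : ∀ v ∈ l, ∀ w ∈ l, S.c (f v) (f w) = S.c v w)
    (hx : x ∉ l) (hy : y ∉ l)
    (h : S.Tm X Y (l.map f) c) : S.Tm x y l c := by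
  obtain ⟨h0, X', Y', h1, h2, h3, h4⟩ := h
  have z0 := S.zero
  have sy := S.symm
  have hX0 : ∀ v ∈ l, S.c X' (f v) = S.c x v := fun v hv => by
    rw [(h4 (f v) (List.mem_map_of_mem hv)).1, hXf v hv]
  have hY0 : ∀ v ∈ l, S.c Y' (f v) = S.c y v := fun v hv => by
    rw [(h4 (f v) (List.mem_map_of_mem hv)).2, hYf v hv]
  obtain ⟨g, hg⟩ := copy (S := S) [X'] (l.map (fun v => (f v, v))) []
    (by
      intro p hp
      obtain ⟨v, hv, rfl⟩ := List.mem_map.1 hp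
      exact hf v hv)
    (by
      intro p hp p' hp'
      obtain ⟨v, hv, rfl⟩ := List.mem_map.1 hp
      obtain ⟨w, hw, rfl⟩ := List.mem_map.1 hp'
      exact hff v hv w hw) (by simp)
    (by
      intro u hu p hp
      obtain ⟨v, hv, rfl⟩ := List.mem_map.1 hp
      have := hX0 v hv
      grind)
  obtain ⟨e1, -, e2, -⟩ := hg X' (by simp)
  have e2' : ∀ v ∈ l, S.c (g X') v = S.c x v := fun v hv => by
    rw [e2 (f v, v) (List.mem_map.2 ⟨v, hv, rfl⟩)]; exact hX0 v hv
  obtain ⟨k, hk⟩ := copy (S := S) [Y'] ((X', g X') :: l.map (fun v => (f v, v))) []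
    (by
      intro p hp
      rcases List.mem_cons.1 hp with rfl | hp
      · exact e1.symm
      obtain ⟨v, hv, rfl⟩ := List.mem_map.1 hp
      exact hf v hv)
    (by
      intro p hp p' hp'
      have e3 : ∀ v ∈ l, S.c X' (f v) = S.c (g X') v := fun v hv => by rw [e2' v hv, hX0 v hv]
      rcases List.mem_cons.1 hp with rfl | hp <;> rcases List.mem_cons.1 hp' with rfl | hp'
      · simp [S.self0]
      · obtain ⟨w, hw, rfl⟩ := List.mem_map.1 hp'
        exact e3 w hw
      · obtain ⟨w, hw, rfl⟩ := List.mem_map.1 hp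
        have := e3 w hw
        grind
      · obtain ⟨v, hv, rfl⟩ := List.mem_map.1 hp
        obtain ⟨w, hw, rfl⟩ := List.mem_map.1 hp'
        exact hff v hv w hw) (by simp)
    (by
      intro u hu p hp
      have hu : u = Y' := by simpa using hu
      subst hu
      rcases List.mem_cons.1 hp with rfl | hp
      · simp only; grind
      obtain ⟨v, hv, rfl⟩ := List.mem_map.1 hp
      have := hY0 v hv
      grind)
  obtain ⟨m1, -, m2, -⟩ := hk Y' (by simp)
  refine ⟨h0, g X', k Y', by rw [e1, h1, hX], by rw [m1, h2, hY], ?_, ?_⟩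
  · have := m2 (X', g X') (by simp)
    grind
  · intro v hv
    refine ⟨e2' v hv, ?_⟩
    rw [m2 (f v, v) (List.mem_cons_of_mem _ (List.mem_map.2 ⟨v, hv, rfl⟩))]
    exact hY0 v hv
end AS

namespace AS

theorem goal_step {V Θ : Type} (S : AS V Θ) (x0 y0 u x y : V) (l : List V)
    (hx : S.τ x0 = S.τ x) (hy : S.τ y0 = S.τ y) (h1 : x0 ≠ y0) (h2 : x0 ≠ u) (h3 : y0 ≠ u)
    (hd : (x :: y :: l).Nodup) (hq : ∀ z ∈ l, ∃ c, S.Q x0 y0 u c ∧ S.Q x y z c) :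
    ∃ X Y l', (u :: X :: Y :: l').Nodup ∧ S.τ X = S.τ x ∧ S.τ Y = S.τ y ∧ S.c X u = S.c x0 u ∧
      S.c Y u = S.c y0 u ∧ l'.length = l.length ∧
      (∀ z' ∈ l', ∃ z ∈ l, ∀ c, S.Q X Y z' c ↔ S.Q x y z c) ∧
      ∀ c, S.Tm X Y (u :: l') c → S.Tm x y l c := by
  have sy := S.symm
  have z0 := S.zero
  obtain ⟨c, q1, n0, x', y', g1, g2, g3, g4⟩ := claim1 l.length S x0 y0 u x y l rfl hx hy h1 h2 h3 hd hq
  obtain ⟨X, Y, k1, k2, k3, k4, k5, k6, k7, k8⟩ := Q_move q1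
  simp only [List.nodup_cons, List.mem_cons, not_or] at hd
  obtain ⟨⟨hd1, hd2⟩, hd3, hd4⟩ := hd
  obtain ⟨f, hf⟩ := copy (S := S) l [(x', X), (y', Y)] [u] (by simp; grind)
    (by simp [S.self0]; grind) hd4
    (by
      intro v hv
      have := g4 v hv
      simp
      grind)
  have hXf : ∀ v ∈ l, S.c X (f v) = S.c x v := fun v hv => by
    have := (hf v hv).2.2.1 (x', X) (by simp)
    have := g4 v hv
    grind
  have hYf : ∀ v ∈ l, S.c Y (f v) = S.c y v := fun v hv => by
    have := (hf v hv).2.2.1 (y', Y) (by simp)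
    have := g4 v hv
    grind
  refine ⟨X, Y, l.map f, ?_, k1.trans hx, k2.trans hy, k3, k4, by simp, ?_, ?_⟩
  · simp only [List.nodup_cons, List.mem_cons, not_or, List.mem_map]
    refine ⟨⟨k7.symm, k8.symm, ?_⟩, ⟨k6, ?_⟩, ?_, ?_⟩
    · rintro ⟨v, hv, e⟩
      exact (hf v hv).2.1 (by simp [e])
    · rintro ⟨v, hv, e⟩
      have := hXf v hv
      grind
    · rintro ⟨v, hv, e⟩
      have := hYf v hv
      grind
    · refine List.Nodup.map_on ?_ hd4
      intro v hv w hw e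
      have := (hf v hv).2.2.2 w hw
      grind
  · intro z' hz'
    obtain ⟨z, hz, rfl⟩ := List.mem_map.1 hz'
    refine ⟨z, hz, fun c => ?_⟩
    unfold Q
    rw [k1.trans hx, k2.trans hy, (hf z hz).1, hXf z hz, hYf z hz]
  · rintro c ⟨t0, X', Y', t1, t2, t3, t4⟩
    refine Tm_transfer (f := f) (k1.trans hx) (k2.trans hy) (fun v hv => (hf v hv).1) hXf hYf
      (fun v hv => (hf v hv).2.2.2) hd2 hd3 ⟨t0, X', Y', t1, t2, t3, fun v hv => t4 v (by simp [hv])⟩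

theorem goal {ι : Type} [Fintype ι] [Nonempty ι] (n : ℕ) : ∀ {V Θ : Type} (S : AS V Θ) (a b : Θ)
    (x y : ι → V) (l : ι → List V), ∑ j, (l j).length = n → (∀ j, S.τ (x j) = a) →
    (∀ j, S.τ (y j) = b) → (∀ j, (x j :: y j :: l j).Nodup) →
    (∀ j j', ∀ z ∈ l j, ∀ w ∈ l j', ∃ c, S.Q (x j) (y j) z c ∧ S.Q (x j') (y j') w c) →
    ∃ c, ∀ j, S.Tm (x j) (y j) (l j) c := by
  classical
  induction n using Nat.strong_induction_on with
  | _ n ih =>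
  intro V Θ S a b x y l hn hx hy hd hq
  have z0 := S.zero
  by_cases hE : ∀ j, l j = []
  · obtain ⟨j0⟩ := ‹Nonempty ι›
    refine ⟨S.c (x j0) (y j0), fun j => ⟨?_, x j0, y j0, ?_, ?_, rfl, ?_⟩⟩
    · have := hd j0
      simp at this
      grind
    · rw [hx, hx]
    · rw [hy, hy]
    · simp [hE]
  push Not at hE
  obtain ⟨j0, hj0⟩ := hE
  obtain ⟨u, t, hut⟩ := List.exists_cons_of_ne_nil hj0
  have hd0 := hd j0
  rw [hut] at hd0
  simp only [List.nodup_cons, List.mem_cons, not_or] at hd0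
  obtain ⟨⟨p1, p2, p3⟩, ⟨p4, p5⟩, p6, p7⟩ := hd0
  have H : ∀ j, ∃ X Y l', (u :: X :: Y :: l').Nodup ∧ S.τ X = a ∧ S.τ Y = b ∧
      S.c X u = S.c (x j0) u ∧
      S.c Y u = S.c (y j0) u ∧ l'.length ≤ (l j).length ∧ (j = j0 → l'.length < (l j).length) ∧
      (∀ z' ∈ l', ∃ z ∈ l j, ∀ c, S.Q X Y z' c ↔ S.Q (x j) (y j) z c) ∧
      ∀ c, S.Tm X Y (u :: l') c → S.Tm (x j) (y j) (l j) c := by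
    intro j
    by_cases hj : j = j0
    · subst hj
      refine ⟨x j, y j, t, ?_, hx j, hy j, rfl, rfl, by simp [hut], by simp [hut], ?_, ?_⟩
      · simp only [List.nodup_cons, List.mem_cons, not_or]
        grind
      · intro z hz
        exact ⟨z, by simp [hut, hz], fun c => Iff.rfl⟩
      · rw [hut]
        exact fun c h => h
    · obtain ⟨X, Y, l', e1, e2, e3, e4, e5, e6, e7, e8⟩ := goal_step S (x j0) (y j0) u (x j) (y j) (l j)
        (by rw [hx, hx]) (by rw [hy, hy]) p1 p2 p4 (hd j)
        (fun z hz => hq j0 j u (by simp [hut]) z hz)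
      exact ⟨X, Y, l', e1, e2.trans (hx j), e3.trans (hy j), e4, e5, e6.le, fun h => absurd h hj,
        e7, e8⟩
  choose X Y l' e1 e2 e3 e4 e5 e6 e7 e8 e9 using H
  have e1' : ∀ j, X j ≠ u ∧ Y j ≠ u ∧ X j ≠ Y j ∧ (∀ z ∈ l' j, z ≠ u ∧ z ≠ X j ∧ z ≠ Y j) ∧ (l' j).Nodup := by
    intro j
    have := e1 j
    simp only [List.nodup_cons, List.mem_cons, not_or] at this
    grind
  have hlu : ∀ j, ∀ z ∈ l' j, z ≠ u := fun j z hz => ((e1' j).2.2.2.1 z hz).1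
  obtain ⟨c, hc⟩ := ih (∑ j, (l' j).length)
    (by
      rw [← hn]
      exact Finset.sum_lt_sum (fun j _ => e6 j) ⟨j0, Finset.mem_univ _, e7 j0 rfl⟩)
    (S.base u) (a, S.c (x j0) u) (b, S.c (y j0) u) (fun j => ⟨X j, (e1' j).1⟩)
    (fun j => ⟨Y j, (e1' j).2.1⟩) (fun j => (l' j).attachWith _ (hlu j)) (by simp)
    (fun j => by simp [base, e2, e4]) (fun j => by simp [base, e3, e5])
    (by
      intro j
      rw [← List.nodup_map_iff Subtype.val_injective]
      simp only [List.map_cons, attach_map]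
      exact (List.nodup_cons.1 (e1 j)).2)
    (by
      rintro j j' ⟨z, hzu⟩ hz ⟨w, hwu⟩ hw
      have hz : z ∈ l' j := by simpa [List.mem_attachWith] using hz
      have hw : w ∈ l' j' := by simpa [List.mem_attachWith] using hw
      obtain ⟨z1, hz1, hzQ⟩ := e8 j z hz
      obtain ⟨w1, hw1, hwQ⟩ := e8 j' w hw
      obtain ⟨c1, a1, a2⟩ := hq j0 j u (by simp [hut]) z1 hz1
      obtain ⟨c2, a3, a4⟩ := hq j0 j' u (by simp [hut]) w1 hw1
      obtain ⟨c3, a5, a6⟩ := hq j j' z1 hz1 w1 hw1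
      refine BCQ (u := u) (x := x j0) (y := y j0) (c1 := c1) (c2 := c2) (c3 := c3)
        (by rw [e2, hx]) (by rw [e3, hy]) (e4 j) (e5 j) (by rw [e2, hx]) (by rw [e3, hy])
        (e4 j') (e5 j') a1 ((hzQ _).2 a2) a3 ((hwQ _).2 a4) ((hzQ _).2 a5) ((hwQ _).2 a6) ?_ ?_
        _ _ _ _ _ _
      · have := e1' j
        simp; grind
      · have := e1' j'
        simp; grind)
  refine ⟨c, fun j => e9 j c ?_⟩
  have := of_base_Tm u (hc j)
  simpa only [attach_map] using this
end AS


/-- Homogeneous structures with generic pairs. -/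
structure HS (V Θ : Type) where
  τ : V → Θ
  c : V → V → ℕ
  symm : ∀ v w, c v w = c w v
  zero : ∀ v w, c v w = 0 ↔ v = w
  same : ∀ v w, τ v = τ w → v ≠ w → c v w = 1
  hom : ∀ (D : Finset V) (φ : V → V), (∀ v ∈ D, τ (φ v) = τ v) →
    (∀ v ∈ D, ∀ w ∈ D, c (φ v) (φ w) = c v w) →
    ∃ ψ : V ≃ V, (∀ v, τ (ψ v) = τ v) ∧ (∀ v w, c (ψ v) (ψ w) = c v w) ∧ ∀ v ∈ D, ψ v = φ v
  inf : ∀ x, {y | τ y = τ x}.Infinite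
  gen : ∀ x x' b, τ x = τ x' → τ b ≠ τ x → ∃ b', τ b' = τ b ∧ c b' x = c b x ∧ c b' x' = c b x

namespace HS
variable {V Θ : Type} [DecidableEq V] (H : HS V Θ)

def Typ (A : Finset V) (x : V) : Set V := {x' | H.τ x' = H.τ x ∧ ∀ a ∈ A, H.c x' a = H.c x a}

variable {H}

theorem auto1 {A : Finset V} {x x' : V} (hx : x ∉ A) (h : x' ∈ H.Typ A x) :
    ∃ ψ : V ≃ V, (∀ v, H.τ (ψ v) = H.τ v) ∧ (∀ v w, H.c (ψ v) (ψ w) = H.c v w) ∧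
      (∀ v ∈ A, ψ v = v) ∧ ψ x = x' := by
  have sy := H.symm
  have z0 : ∀ v, H.c v v = 0 := fun v => (H.zero v v).2 rfl
  have hne : ∀ v ∈ A, v ≠ x := fun v hv e => hx (e ▸ hv)
  obtain ⟨ψ, h1, h2, h3⟩ := H.hom (insert x A) (fun v => if v = x then x' else v)
    (by
      intro v hv
      have := h.1
      grind)
    (by
      intro v hv w hw
      have h2 := h.2
      simp only [Finset.mem_insert] at hv hw
      rcases hv with rfl | hv <;> rcases hw with rfl | hw
      · simp [z0]
      · simp only [if_true, if_neg (hne _ hw)]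
        exact h2 w hw
      · simp only [if_true, if_neg (hne _ hv)]
        rw [sy, sy v]
        exact h2 v hv
      · rw [if_neg (hne _ hv), if_neg (hne _ hw)])
  refine ⟨ψ, h1, h2, fun v hv => ?_, ?_⟩
  · rw [h3 v (by simp [hv]), if_neg (hne v hv)]
  · rw [h3 x (by simp), if_pos rfl]

variable (H) in
def Inst (n : ℕ) (A : Finset V) (x : V) : Prop := x ∉ A ∧ A.card = n ∧ (H.Typ A x).Finite

variable (H) in
def Mini (n : ℕ) : Prop := ∀ A x, x ∉ A → A.card < n → (H.Typ A x).Infinite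

theorem step1 {n : ℕ} (hn : H.Mini n) {A : Finset V} {x : V} (hI : H.Inst n A x) {a : V} (ha : a ∈ A) :
    H.τ a ≠ H.τ x := by
  intro e
  obtain ⟨h1, h2, h3⟩ := hI
  have h0 := Finset.card_pos.2 ⟨a, ha⟩
  have := hn (A.erase a) x (by simp [h1]) (by rw [Finset.card_erase_of_mem ha]; omega)
  refine (this.sdiff (Set.finite_singleton a)) (h3.subset ?_)
  rintro x' ⟨⟨g1, g2⟩, g3⟩
  refine ⟨g1, fun b hb => ?_⟩
  by_cases hba : b = a
  · subst hba
    rw [H.same x' b (by rw [g1, e]) (by simpa using g3), H.same x b e.symm (by grind)]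
  · exact g2 b (by simp [hba, hb])

theorem step2 {n : ℕ} (hn : H.Mini n) {A : Finset V} {x : V} (hI : H.Inst n A x) :
    ∀ x' ∈ H.Typ A x, x' = x := by
  have sy := H.symm
  have z0 := H.zero
  obtain ⟨h1, h2, h3⟩ := hI
  have hne : A.Nonempty := by
    rw [Finset.nonempty_iff_ne_empty]
    rintro rfl
    refine H.inf x ?_
    convert h3 using 1
    ext y
    simp [Typ]
  obtain ⟨b, hb⟩ := hne
  have hpos := Finset.card_pos.2 ⟨b, hb⟩
  have hxb : x ≠ b := fun e => h1 (e ▸ hb)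
  have hP := hn (A.erase b) x (by simp [h1]) (by rw [Finset.card_erase_of_mem hb]; omega)
  set A0 := A.erase b with hA0
  have hbA0 : b ∉ A0 := by simp [A0]
  have hxA0 : x ∉ A0 := by simp [A0, h1]
  have hmem : ∀ {P : V → Prop}, (∀ a ∈ A, P a) ↔ ((∀ a ∈ A0, P a) ∧ P b) := by
    intro P
    rw [← Finset.insert_erase hb, Finset.forall_mem_insert, and_comm]
  have hOT : ∀ y, y ∈ H.Typ A x ↔ y ∈ H.Typ A0 x ∧ H.c y b = H.c x b := by
    intro y
    simp only [Typ, Set.mem_ofPred_eq, hmem, and_assoc]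
  intro x2 hx2
  by_contra hx2n
  have hPO := hP.sdiff h3
  obtain ⟨x3, hx3P, hx3O⟩ := hPO.nonempty
  have hxO : x ∈ H.Typ A x := ⟨rfl, fun _ _ => rfl⟩
  have hx3x : x3 ≠ x := fun e => hx3O (e ▸ hxO)
  have hx2' := (hOT x2).1 hx2
  obtain ⟨ψ1, a1, a2, a3, a4⟩ := auto1 (H := H) (A := insert x A0) (x := x2) (x' := x3)
    (by
      simp only [Finset.mem_insert, not_or]
      refine ⟨hx2n, fun h => ?_⟩
      have := hx2'.1.2 x2 h
      grind)
    ⟨hx3P.1.trans hx2'.1.1.symm, by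
      intro a ha
      rcases Finset.mem_insert.1 ha with rfl | ha
      · rw [H.same _ _ hx3P.1 hx3x, H.same _ _ hx2'.1.1 hx2n]
      · rw [hx3P.2 a ha, hx2'.1.2 a ha]⟩
  have b1x : H.c x (ψ1 b) = H.c x b := by
    rw [← a2 x b, a3 x (by simp)]
  have b1x3 : H.c x3 (ψ1 b) = H.c x b := by
    rw [← a4, a2, hx2'.2]
  have b1b : ψ1 b ≠ b := by
    intro e
    rw [e] at b1x3
    exact hx3O ((hOT x3).2 ⟨hx3P, b1x3⟩)
  have : Finite (H.Typ A x) := h3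
  obtain ⟨i1, hi1⟩ := Countable.exists_injective_nat (H.Typ A x)
  let i2 := hPO.natEmbedding
  let g : V → V := fun v => by
    classical exact if h : v ∈ H.Typ A x then (i2 (i1 ⟨v, h⟩)).1 else v
  have hg : ∀ v, v ∈ H.Typ A x → g v ∈ H.Typ A0 x \ H.Typ A x := by
    intro v hv
    simp only [g, dif_pos hv]
    exact (i2 (i1 ⟨v, hv⟩)).2
  have hginj : ∀ v w, v ∈ H.Typ A x → w ∈ H.Typ A x → g v = g w → v = w := by
    intro v w hv hw e
    simp only [g, dif_pos hv, dif_pos hw] at e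
    have := hi1 (i2.injective (Subtype.ext e))
    simpa using this
  have hOA0 : ∀ v ∈ A0, v ∉ H.Typ A x := by
    intro v hv h
    have := h.2 v (Finset.mem_of_mem_erase hv)
    grind
  have hgA0 : ∀ v ∈ A0, g v = v := by
    intro v hv
    simp only [g, dif_neg (hOA0 v hv)]
  obtain ⟨ψ2, c1, c2, c3⟩ := H.hom (A0 ∪ h3.toFinset) g
    (by
      intro v hv
      rcases Finset.mem_union.1 hv with hv | hv
      · rw [hgA0 v hv]
      · rw [Set.Finite.mem_toFinset] at hv
        rw [(hg v hv).1.1, hv.1])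
    (by
      intro v hv w hw
      rcases Finset.mem_union.1 hv with hv | hv <;> rcases Finset.mem_union.1 hw with hw | hw
      · rw [hgA0 v hv, hgA0 w hw]
      · rw [Set.Finite.mem_toFinset] at hw
        rw [hgA0 v hv, sy, sy v, (hg w hw).1.2 v hv, hw.2 v (Finset.mem_of_mem_erase hv)]
      · rw [Set.Finite.mem_toFinset] at hv
        rw [hgA0 w hw, (hg v hv).1.2 w hw, hv.2 w (Finset.mem_of_mem_erase hw)]
      · rw [Set.Finite.mem_toFinset] at hv hw
        by_cases e : v = w
        · subst e
          grind
        · rw [H.same v w (hv.1.trans hw.1.symm) e,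
            H.same _ _ ((hg v hv).1.1.trans (hg w hw).1.1.symm) (fun h => e (hginj v w hv hw h))])
  have hdis : ∀ y ∈ H.Typ A x, H.c y (ψ2 b) ≠ H.c x b := by
    intro y hy e
    have hy' : ψ2.symm y ∈ H.Typ A x := by
      rw [hOT]
      refine ⟨⟨?_, ?_⟩, ?_⟩
      · rw [← c1, Equiv.apply_symm_apply, hy.1]
      · intro a ha
        rw [← c2, Equiv.apply_symm_apply, c3 a (by simp [ha]), hgA0 a ha]
        exact hy.2 a (Finset.mem_of_mem_erase ha)
      · rw [← c2, Equiv.apply_symm_apply, e]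
    have := c3 (ψ2.symm y) (by simp [hy'])
    rw [Equiv.apply_symm_apply] at this
    exact (hg _ hy').2 (this ▸ hy)
  have b2b : ψ2 b ≠ b := by
    intro e
    exact hdis x hxO (by rw [e])
  obtain ⟨χ, d1, d2, d3, d4⟩ := auto1 (H := H) (A := insert b A0) (x := ψ1 b) (x' := ψ2 b)
    (by
      simp only [Finset.mem_insert, not_or]
      refine ⟨b1b, fun h => ?_⟩
      have := a3 (ψ1 b) (by simp [h])
      exact b1b (ψ1.injective this))
    ⟨by rw [a1, c1], by
      intro a ha
      rcases Finset.mem_insert.1 ha with rfl | ha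
      · rw [H.same _ _ (c1 _) b2b, H.same _ _ (a1 _) b1b]
      · have e1 := a2 b a
        have e2 := c2 b a
        rw [a3 a (by simp [ha])] at e1
        rw [c3 a (by simp [ha]), hgA0 a ha] at e2
        rw [e1, e2]⟩
  refine hdis (χ x) ((hOT _).2 ⟨⟨d1 x, fun a ha => ?_⟩, ?_⟩) ?_
  · have := d2 x a
    rwa [d3 a (by simp [ha])] at this
  · have := d2 x b
    rwa [d3 b (by simp)] at this
  · rw [← d4, d2, b1x]

theorem step3 {n : ℕ} (hn : H.Mini n) {A : Finset V} {x : V} (hI : H.Inst n A x) {b : V} (hb : b ∈ A) :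
    H.Inst n (insert x (A.erase b)) b := by
  have sy := H.symm
  have z0 := H.zero
  have s2 := step2 hn hI
  obtain ⟨h1, h2, h3⟩ := hI
  have hpos := Finset.card_pos.2 ⟨b, hb⟩
  have hxb : x ≠ b := fun e => h1 (e ▸ hb)
  refine ⟨by simp [hxb.symm], ?_, ?_⟩
  · rw [Finset.card_insert_of_notMem (by simp [h1]), Finset.card_erase_of_mem hb]; omega
  refine (Set.finite_singleton b).subset ?_
  have hP := hn (A.erase b) x (by simp [h1]) (by rw [Finset.card_erase_of_mem hb]; omega)
  set A0 := A.erase b with hA0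
  have hbA0 : b ∉ A0 := by simp [A0]
  have hxA0 : x ∉ A0 := by simp [A0, h1]
  have hmem : ∀ {P : V → Prop}, (∀ a ∈ A, P a) ↔ ((∀ a ∈ A0, P a) ∧ P b) := by
    intro P
    rw [← Finset.insert_erase hb, Finset.forall_mem_insert, and_comm]
  have hOT : ∀ y, y ∈ H.Typ A x ↔ y ∈ H.Typ A0 x ∧ H.c y b = H.c x b := by
    intro y
    simp only [Typ, Set.mem_ofPred_eq, hmem, and_assoc]
  intro b' hb'
  by_contra hbn
  have hbn : b' ≠ b := hbn
  obtain ⟨x3, hx3, hx3x⟩ := (hP.sdiff (Set.finite_singleton x)).nonempty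
  have hx3x : x3 ≠ x := hx3x
  obtain ⟨ψ, a1, a2, a3, a4⟩ := auto1 hxA0 hx3
  have b3b : ψ b ≠ b := by
    intro e
    refine hx3x (s2 x3 ((hOT x3).2 ⟨hx3, ?_⟩))
    rw [← a4, ← e, a2, e]
  obtain ⟨χ, d1, d2, d3, d4⟩ := auto1 (H := H) (A := insert b A0) (x := b') (x' := ψ b)
    (by
      simp only [Finset.mem_insert, not_or]
      refine ⟨hbn, fun h => ?_⟩
      have := hb'.2 b' (by simp [h])
      grind)
    ⟨by rw [a1, hb'.1], by
      intro a ha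
      rcases Finset.mem_insert.1 ha with rfl | ha
      · rw [H.same _ _ (a1 _) b3b, H.same _ _ hb'.1 hbn]
      · have e1 := a2 b a
        rw [a3 a ha] at e1
        rw [e1, hb'.2 a (by simp [ha])]⟩
  have hχ : χ x = x := s2 _ ((hOT _).2 ⟨⟨d1 x, fun a ha => by
    have := d2 x a
    rwa [d3 a (by simp [ha])] at this⟩, by
    have := d2 x b
    rwa [d3 b (by simp)] at this⟩)
  have e1 : H.c x (ψ b) = H.c x b := by
    have := d2 x b'
    rw [hχ, d4] at this
    rw [this, sy, hb'.2 x (by simp), sy]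
  have : ψ.symm x = x := s2 _ ((hOT _).2 ⟨⟨by rw [← a1, Equiv.apply_symm_apply], fun a ha => by
    rw [← a2, Equiv.apply_symm_apply, a3 a ha]⟩, by rw [← a2, Equiv.apply_symm_apply, e1]⟩)
  rw [Equiv.symm_apply_eq, a4] at this
  exact hx3x this.symm

theorem step5 {n : ℕ} (hn : H.Mini n) {A : Finset V} {x : V} (hI : H.Inst n A x) : False := by
  have sy := H.symm
  have z0 := H.zero
  have dist : ∀ {A : Finset V} {x : V}, H.Inst n A x → ∀ a ∈ A, ∀ a' ∈ A, a' ≠ a → H.τ a' ≠ H.τ a := by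
    intro A x hI a ha a' ha' hne
    exact step1 hn (step3 hn hI ha) (by simp [ha', hne])
  have sx := step2 hn hI
  have hI' := hI
  obtain ⟨h1, h2, h3⟩ := hI
  have hne : A.Nonempty := by
    rw [Finset.nonempty_iff_ne_empty]
    rintro rfl
    refine H.inf x ?_
    convert h3 using 1
    ext y
    simp [Typ]
  obtain ⟨b, hb⟩ := hne
  have sb := step2 hn (step3 hn hI' hb)
  have txb := step1 hn hI' hb
  by_cases hA : A = {b}
  · subst hA
    obtain ⟨x', hx', hx'x⟩ := ((H.inf x).sdiff (Set.finite_singleton x)).nonempty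
    obtain ⟨b', g1, g2, g3⟩ := H.gen x x' b (Eq.symm hx') txb
    have : b' = b := sb b' ⟨g1, by simpa using g2⟩
    subst this
    exact hx'x (sx x' ⟨hx', by simp; grind⟩)
  obtain ⟨a, ha, hab⟩ : ∃ a ∈ A, a ≠ b := by
    by_contra h
    push Not at h
    exact hA (Finset.eq_singleton_iff_unique_mem.2 ⟨hb, h⟩)
  have sa := step2 hn (step3 hn hI' ha)
  have tab := dist hI' b hb a ha hab
  have hxa : x ≠ a := fun e => h1 (e ▸ ha)
  have hxb : x ≠ b := fun e => h1 (e ▸ hb)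
  set A1 := (A.erase a).erase b with hA1
  have m1 : ∀ v, v ∈ A ↔ v = a ∨ v = b ∨ v ∈ A1 := by
    intro v
    simp only [hA1, Finset.mem_erase]
    grind
  have aA1 : a ∉ A1 := by simp [hA1]
  have bA1 : b ∉ A1 := by simp [hA1]
  have xA1 : x ∉ A1 := by simp [hA1, h1]
  have cA1 : A1.card + 2 = n := by
    have e1 := Finset.card_erase_of_mem ha
    have e2 := Finset.card_erase_of_mem (Finset.mem_erase.2 ⟨hab.symm, hb⟩)
    have : 0 < ((A.erase a)).card := Finset.card_pos.2 ⟨b, Finset.mem_erase.2 ⟨hab.symm, hb⟩⟩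
    rw [← hA1] at e2
    omega
  have hinf := hn (insert x A1) a (by simp [hxa.symm, aA1])
    (by rw [Finset.card_insert_of_notMem xA1]; omega)
  obtain ⟨a', ha', ha'a⟩ := (hinf.sdiff (Set.finite_singleton a)).nonempty
  have ha'a : a' ≠ a := ha'a
  obtain ⟨ψ, p1, p2, p3, p4⟩ := auto1 (by simp [hxa.symm, aA1]) ha'
  have px : ψ x = x := p3 x (by simp)
  have pA : ∀ v ∈ A1, ψ v = v := fun v hv => p3 v (by simp [hv])
  have b'b : ψ b ≠ b := by
    intro e
    refine ha'a (sa a' ⟨ha'.1, ?_⟩)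
    intro v hv
    have hv : v = x ∨ v = b ∨ v ∈ A1 := by grind
    rcases hv with rfl | rfl | hv
    · exact ha'.2 _ (by simp)
    · rw [← p4, ← e, p2, e]
    · exact ha'.2 _ (by simp [hv])
  have b'a : H.c (ψ b) a ≠ H.c b a := by
    intro e
    refine b'b (sb (ψ b) ⟨p1 b, ?_⟩)
    intro v hv
    have hv : v = x ∨ v = a ∨ v ∈ A1 := by grind
    rcases hv with rfl | rfl | hv
    · have := p2 b v
      rwa [px] at this
    · exact e
    · have := p2 b v
      rwa [pA v hv] at this
  have a'A1 : a' ∉ A1 := by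
    intro h
    have := ha'.2 a' (by simp [h])
    grind
  have key : ∀ b'' ∈ H.Typ (insert a (insert a' A1)) (ψ b), b'' = ψ b := by
    intro b'' hb''
    have b''b : b'' ≠ b := by
      rintro rfl
      exact b'a (hb''.2 a (by simp)).symm
    have tb : H.τ b'' = H.τ b := by rw [hb''.1, p1]
    obtain ⟨χ, d1, d2, d3, d4⟩ := auto1 (H := H) (A := A) (x := b'') (x' := ψ b)
      (by
        rw [m1]
        rintro (rfl | rfl | h)
        · exact tab tb
        · exact b''b rfl
        · have := hb''.2 b'' (by simp [h])
          have e : ψ b = b'' := by grind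
          have e2 := pA b'' h
          have : b = b'' := ψ.injective (by rw [e, e2])
          exact b''b this.symm)
      ⟨hb''.1.symm, by
        intro v hv
        rw [m1] at hv
        rcases hv with rfl | rfl | hv
        · exact (hb''.2 _ (by simp)).symm
        · rw [H.same _ _ (p1 _) b'b, H.same _ _ tb b''b]
        · exact (hb''.2 _ (by simp [hv])).symm⟩
    have hχ : χ x = x := sx _ ⟨d1 x, fun v hv => by
      have := d2 x v
      rwa [d3 v hv] at this⟩
    have e1 : H.c (ψ b) x = H.c b'' x := by
      have := d2 b'' x
      rwa [hχ, d4] at this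
    have : ψ.symm b'' = b := by
      refine sb _ ⟨by rw [← p1, Equiv.apply_symm_apply, tb], ?_⟩
      intro v hv
      rw [← p2, Equiv.apply_symm_apply]
      have hv : v = x ∨ v = a ∨ v ∈ A1 := by grind
      rcases hv with rfl | rfl | hv
      · rw [px, ← e1]
        have := p2 b v
        rwa [px] at this
      · rw [p4, hb''.2 a' (by simp), ← p4, p2]
      · rw [pA v hv, hb''.2 v (by simp [hv])]
        have := p2 b v
        rwa [pA v hv] at this
    rw [Equiv.symm_apply_eq] at this
    exact this
  have hI2 : H.Inst n (insert a (insert a' A1)) (ψ b) := by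
    refine ⟨?_, ?_, (Set.finite_singleton (ψ b)).subset key⟩
    · simp only [Finset.mem_insert, not_or]
      refine ⟨fun e => tab ?_, fun e => hab ?_, fun h => ?_⟩
      · rw [← e, p1]
      · rw [← p4] at e
        exact (ψ.injective e).symm
      · exact b'b (ψ.injective (pA _ h))
    · rw [Finset.card_insert_of_notMem (by simp [ha'a.symm, aA1]), Finset.card_insert_of_notMem a'A1]
      omega
  exact dist hI2 a (by simp) a' (by simp) ha'a ha'.1

theorem NA (A : Finset V) : ∀ x, x ∉ A → (H.Typ A x).Infinite := by
  have : ∀ n, H.Mini n := by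
    intro n
    induction n with
    | zero => intro A x _ h; omega
    | succ n ih =>
      intro A x hx hc
      by_cases h : A.card < n
      · exact ih A x hx h
      · intro hf
        exact step5 ih ⟨hx, by omega, hf⟩
  intro x hx
  exact this (A.card + 1) A x hx (by omega)

variable (H) in
def toAS : AS V Θ where
  τ := H.τ
  c := H.c
  symm := H.symm
  zero := H.zero
  same := H.same
  ext l F q h1 h2 h3 := by
    classical
    have hinj : ∀ p ∈ l, ∀ p' ∈ l, p.1 = p'.1 → p.2 = p'.2 := by
      intro p hp p' hp' e
      rw [← H.zero, ← h2 p hp p' hp', H.zero]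
      exact e
    let φ : V → V := fun v => if h : ∃ p ∈ l, p.1 = v then h.choose.2 else v
    have hφ : ∀ p ∈ l, φ p.1 = p.2 := by
      intro p hp
      have h : ∃ p' ∈ l, p'.1 = p.1 := ⟨p, hp, rfl⟩
      simp only [φ, dif_pos h]
      exact hinj _ h.choose_spec.1 _ hp h.choose_spec.2
    obtain ⟨ψ, g1, g2, g3⟩ := H.hom (l.map Prod.fst).toFinset φ
      (by
        intro v hv
        simp only [List.mem_toFinset, List.mem_map] at hv
        obtain ⟨p, hp, rfl⟩ := hv
        rw [hφ p hp, h1 p hp])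
      (by
        intro v hv w hw
        simp only [List.mem_toFinset, List.mem_map] at hv hw
        obtain ⟨p, hp, rfl⟩ := hv
        obtain ⟨p', hp', rfl⟩ := hw
        rw [hφ p hp, hφ p' hp', h2 p hp p' hp'])
    have g4 : ∀ p ∈ l, ψ p.1 = p.2 := by
      intro p hp
      rw [g3 p.1 (by simp only [List.mem_toFinset, List.mem_map]; exact ⟨p, hp, rfl⟩), hφ p hp]
    have hq : ψ q ∉ (l.map Prod.snd).toFinset := by
      simp only [List.mem_toFinset, List.mem_map]
      rintro ⟨p, hp, e⟩
      rw [← g4 p hp] at e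
      exact h3 p hp (ψ.injective e).symm
    obtain ⟨q', k1, k2⟩ := ((NA (H := H) _ _ hq).sdiff (F.toFinset.finite_toSet)).nonempty
    refine ⟨q', fun f hf e => k2 (by simp [e, hf]), by rw [k1.1, g1], fun p hp => ?_⟩
    rw [k1.2 p.2 (by simp only [List.mem_toFinset, List.mem_map]; exact ⟨p, hp, rfl⟩), ← g4 p hp, g2]
end HS


theorem LGraph.exists_nb {G : LGraph L} (hgen : G.Generic) {i j : Fin m} (hij : i ≠ j) (x : G.V)
    (hx : G.part x = i) (c : ℕ) (hc : c ∈ L.C i j) : ∃ y, G.part y = j ∧ G.colour x y = c := by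
  obtain ⟨y, h1, h2⟩ := hgen.2.2 i j hij {x} (by simpa using hx) (fun _ => c) (by simpa using hc)
  exact ⟨y, h1, by rw [G.colour_symm]; exact h2 x (by simp)⟩

open Classical in
noncomputable def LGraph.col (G : LGraph L) (v w : G.V) : ℕ :=
  if v = w then 0 else if G.part v = G.part w then 1 else G.colour v w + 2

theorem LGraph.col_zero (G : LGraph L) (v w : G.V) : G.col v w = 0 ↔ v = w := by
  unfold LGraph.col
  split_ifs <;> simp_all

theorem LGraph.col_same (G : LGraph L) (v w : G.V) (h : G.part v = G.part w) (hn : v ≠ w) :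
    G.col v w = 1 := by
  unfold LGraph.col
  rw [if_neg hn, if_pos h]

theorem LGraph.col_diff (G : LGraph L) (v w : G.V) (h : G.part v ≠ G.part w) :
    G.col v w = G.colour v w + 2 := by
  unfold LGraph.col
  rw [if_neg (fun e => h (by rw [e])), if_neg h]

theorem LGraph.col_symm (G : LGraph L) (v w : G.V) : G.col v w = G.col w v := by
  by_cases e : v = w
  · rw [e]
  · by_cases p : G.part v = G.part w
    · rw [G.col_same _ _ p e, G.col_same _ _ p.symm (Ne.symm e)]
    · rw [G.col_diff _ _ p, G.col_diff _ _ (Ne.symm p), G.colour_symm]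

theorem LGraph.col_congr (G : LGraph L) {v w v' w' : G.V} (h1 : v = w ↔ v' = w')
    (h2 : G.part v = G.part v') (h3 : G.part w = G.part w')
    (h4 : G.part v ≠ G.part w → G.colour v w = G.colour v' w') : G.col v w = G.col v' w' := by
  by_cases e : v = w
  · rw [(G.col_zero _ _).2 e, (G.col_zero _ _).2 (h1.1 e)]
  · by_cases p : G.part v = G.part w
    · rw [G.col_same _ _ p e, G.col_same _ _ (by rw [← h2, ← h3, p]) (fun h => e (h1.2 h))]
    · rw [G.col_diff _ _ p, G.col_diff _ _ (by rwa [← h2, ← h3]), h4 p]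

noncomputable def LGraph.toHS (G : LGraph L) (hG : G.Homogeneous) (hgen : G.Generic) :
    HS G.V (Fin m) where
  τ := G.part
  c := G.col
  symm := G.col_symm
  zero := G.col_zero
  same := G.col_same
  hom D φ h1 h2 := by
    obtain ⟨ψ, g1, g2, g3⟩ := hG (D : Set G.V) D.finite_toSet φ
      ⟨fun x hx y hy e => by
        rw [← G.col_zero, ← h2 x hx y hy, G.col_zero]; exact e,
        h1, fun x hx y hy p => by
          have := h2 x hx y hy
          rw [G.col_diff _ _ p, G.col_diff _ _ (by rwa [h1 x hx, h1 y hy])] at this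
          omega⟩
    exact ⟨ψ, g1, fun v w => G.col_congr (by simp) (g1 v) (g1 w) (fun p => g2 v w (by
      rwa [← g1 v, ← g1 w])), g3⟩
  inf x := hgen.2.1 (G.part x)
  gen x x' b h1 h2 := by
    classical
    obtain ⟨y, e1, e2⟩ := hgen.2.2 (G.part x) (G.part b) h2.symm {x, x'} (by simp [h1])
      (fun _ => G.colour b x) (fun _ _ => by rw [L.symm]; exact G.colour_mem _ _ h2)
    refine ⟨y, e1, ?_, ?_⟩
    · rw [G.col_diff _ _ (by rwa [e1]), G.col_diff _ _ h2, e2 x (by simp)]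
    · rw [G.col_diff _ _ (by rwa [e1, ← h1]), G.col_diff _ _ h2, e2 x' (by simp)]

open Classical in
noncomputable def LGraph.toAS (G : LGraph L) (hG : G.Homogeneous) (hgen : G.Generic) :
    AS G.V (Fin m) := (G.toHS hG hgen).toAS

section
variable {G : LGraph L} (hG : G.Homogeneous) (hgen : G.Generic)

theorem toAS_τ (v : G.V) : (G.toAS hG hgen).τ v = G.part v := rfl
theorem toAS_c (v w : G.V) : (G.toAS hG hgen).c v w = G.col v w := rfl

/-- The triangle graph. -/
def triG (i j k : Fin m) (c cik cjk : ℕ) (hc : c ∈ L.C i j) (hik : cik ∈ L.C i k)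
    (hjk : cjk ∈ L.C j k) : LGraph L where
  V := Fin 3
  part := ![i, j, k]
  colour a b := match a.val + b.val with
    | 1 => c
    | 2 => cik
    | _ => cjk
  colour_symm a b := by rw [Nat.add_comm]
  colour_mem a b h := by
    have e1 := L.symm j i
    have e2 := L.symm k i
    have e3 := L.symm k j
    fin_cases a <;> fin_cases b <;> simp_all

theorem tri_omit {i j k : Fin m} (hij : i ≠ j) (hik : i ≠ k) (hjk : j ≠ k) {c cik cjk : ℕ}
    (hc : c ∈ L.C i j) (hcik : cik ∈ L.C i k) (hcjk : cjk ∈ L.C j k)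
    (hR : ¬ (G.toAS hG hgen).R3 i j k (c + 2) (cik + 2) (cjk + 2)) :
    ∃ B : LGraph L, G.MinOmitted B ∧ B.IsTriangleOn i j k ∧ B.Covers i j c ∧
      (∀ x y : B.V, B.part x = i → B.part y = k → B.colour x y = cik) ∧
      (∀ x y : B.V, B.part x = j → B.part y = k → B.colour x y = cjk) := by
  have hex : ∀ i, ∃ x, G.part x = i := fun i => (hgen.2.1 i).nonempty
  have sy := G.colour_symm
  have key : ∀ (S : Set (Fin 3)) (u v w : G.V), G.part u = i → G.part v = j → G.part w = k →
      ((0 : Fin 3) ∈ S → (1 : Fin 3) ∈ S → G.colour u v = c) →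
      ((0 : Fin 3) ∈ S → (2 : Fin 3) ∈ S → G.colour u w = cik) →
      ((1 : Fin 3) ∈ S → (2 : Fin 3) ∈ S → G.colour v w = cjk) →
      G.Realized ((triG i j k c cik cjk hc hcik hcjk).restrict S) := by
    intro S u v w hu hv hw h1 h2 h3
    have hp : ∀ a : Fin 3, G.part ((![u, v, w] : Fin 3 → G.V) a) = (![i, j, k] : Fin 3 → Fin m) a := by
      intro a
      fin_cases a <;> simp [hu, hv, hw]
    refine ⟨fun a => (![u, v, w] : Fin 3 → G.V) a.1, ?_, fun a => hp a.1, ?_⟩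
    · rintro ⟨a, ha⟩ ⟨b, hb⟩ e
      apply Subtype.ext
      have e : (![u, v, w] : Fin 3 → G.V) a = (![u, v, w] : Fin 3 → G.V) b := e
      have e2 := congrArg G.part e
      have e2 := ((hp a).symm.trans e2).trans (hp b)
      change (a : Fin 3) = b
      change Fin 3 at a b
      fin_cases a <;> fin_cases b <;> first | rfl | simp_all
    · rintro ⟨a, ha⟩ ⟨b, hb⟩ h
      change (![i, j, k] : Fin 3 → Fin m) a ≠ (![i, j, k] : Fin 3 → Fin m) b at h
      change G.colour ((![u, v, w] : Fin 3 → G.V) a) ((![u, v, w] : Fin 3 → G.V) b) =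
        (triG i j k c cik cjk hc hcik hcjk).colour a b
      change Fin 3 at a b
      fin_cases a <;> fin_cases b <;> simp [triG] at h ha hb ⊢ <;>
        first
        | exact h1 ha hb
        | exact h2 ha hb
        | exact h3 ha hb
        | (rw [sy]; exact h1 hb ha)
        | (rw [sy]; exact h2 hb ha)
        | (rw [sy]; exact h3 hb ha)
  refine ⟨triG i j k c cik cjk hc hcik hcjk, ⟨inferInstanceAs (Finite (Fin 3)), ?_, ?_⟩,
    ⟨?_, ?_, ⟨(0 : Fin 3), rfl⟩, ⟨(1 : Fin 3), rfl⟩, ⟨(2 : Fin 3), rfl⟩⟩,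
    ⟨(0 : Fin 3), (1 : Fin 3), rfl, rfl, rfl⟩, ?_, ?_⟩
  · rintro ⟨f, f1, f2, f3⟩
    have p0 : G.part (f (0 : Fin 3)) = i := f2 (0 : Fin 3)
    have p1 : G.part (f (1 : Fin 3)) = j := f2 (1 : Fin 3)
    have p2 : G.part (f (2 : Fin 3)) = k := f2 (2 : Fin 3)
    refine hR ⟨f (0 : Fin 3), f (1 : Fin 3), f (2 : Fin 3), p0, p1, p2, ?_, ?_, ?_, by omega, by omega, by omega⟩
    · rw [toAS_c, G.col_diff _ _ (by rw [p0, p1]; exact hij)]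
      rw [f3 (0 : Fin 3) (1 : Fin 3) hij]; rfl
    · rw [toAS_c, G.col_diff _ _ (by rw [p0, p2]; exact hik)]
      rw [f3 (0 : Fin 3) (2 : Fin 3) hik]; rfl
    · rw [toAS_c, G.col_diff _ _ (by rw [p1, p2]; exact hjk)]
      rw [f3 (1 : Fin 3) (2 : Fin 3) hjk]; rfl
  · intro S hS
    obtain ⟨a, ha⟩ := (Set.ne_univ_iff_exists_notMem S).1 hS
    change Set (Fin 3) at S
    change Fin 3 at a
    have ha : a ∉ S := ha
    obtain ⟨u, hu⟩ := hex i
    obtain ⟨v, hv⟩ := hex j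
    have H : (0 : Fin 3) ∉ S ∨ (1 : Fin 3) ∉ S ∨ (2 : Fin 3) ∉ S := by
      fin_cases a
      · exact Or.inl ha
      · exact Or.inr (Or.inl ha)
      · exact Or.inr (Or.inr ha)
    rcases H with h | h | h
    · obtain ⟨w, hw, hw'⟩ := exists_nb hgen hjk v hv cjk hcjk
      exact key S u v w hu hv hw (fun h' => absurd h' h) (fun h' => absurd h' h) (fun _ _ => hw')
    · obtain ⟨w, hw, hw'⟩ := exists_nb hgen hik u hu cik hcik
      exact key S u v w hu hv hw (fun _ h' => absurd h' h) (fun _ _ => hw') (fun h' => absurd h' h)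
    · obtain ⟨v, hv, hv'⟩ := exists_nb hgen hij u hu c hc
      obtain ⟨w, hw⟩ := hex k
      exact key S u v w hu hv hw (fun _ _ => hv') (fun _ h' => absurd h' h) (fun _ h' => absurd h' h)
  · intro a b e
    change (![i, j, k] : Fin 3 → Fin m) a = (![i, j, k] : Fin 3 → Fin m) b at e
    change Fin 3 at a b
    fin_cases a <;> fin_cases b <;> first | rfl | (simp at e; grind)
  · intro a
    change Fin 3 at a
    fin_cases a
    · exact Or.inl rfl
    · exact Or.inr (Or.inl rfl)
    · exact Or.inr (Or.inr rfl)
  · intro a b e e'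
    change (![i, j, k] : Fin 3 → Fin m) a = i at e
    change (![i, j, k] : Fin 3 → Fin m) b = k at e'
    change Fin 3 at a b
    fin_cases a <;> fin_cases b <;> first | rfl | (simp at e e'; grind)
  · intro a b e e'
    change (![i, j, k] : Fin 3 → Fin m) a = j at e
    change (![i, j, k] : Fin 3 → Fin m) b = k at e'
    change Fin 3 at a b
    fin_cases a <;> fin_cases b <;> first | rfl | (simp at e e'; grind)

theorem realize_part [Nonempty G.V] {A : LGraph L} (hA : A.Monic) {S : Set A.V}
    (h : G.Realized (A.restrict S)) : ∃ f : A.V → G.V, (∀ z ∈ S, G.part (f z) = A.part z) ∧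
      ∀ z ∈ S, ∀ w ∈ S, z ≠ w → G.col (f z) (f w) = A.colour z w + 2 := by
  classical
  obtain ⟨f, f1, f2, f3⟩ := h
  refine ⟨fun z => if h : z ∈ S then f ⟨z, h⟩ else Classical.arbitrary _, ?_, ?_⟩
  · intro z hz
    simp only [dif_pos hz]
    exact f2 ⟨z, hz⟩
  · intro z hz w hw hn
    simp only [dif_pos hz, dif_pos hw]
    have hp : A.part z ≠ A.part w := fun e => hn (hA _ _ e)
    have e1 : G.part (f ⟨z, hz⟩) = A.part z := f2 ⟨z, hz⟩
    have e2 : G.part (f ⟨w, hw⟩) = A.part w := f2 ⟨w, hw⟩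
    rw [G.col_diff _ _ (by rw [e1, e2]; exact hp), f3 ⟨z, hz⟩ ⟨w, hw⟩ hp]
    rfl

theorem realize (hG : G.Homogeneous) (hgen : G.Generic) {A : LGraph L} (hA : A.Monic)
    (hO : G.MinOmitted A) {x y : A.V} (hxy : x ≠ y) :
    ∃ (X Y : G.V) (g : A.V → G.V) (M : List A.V), M.Nodup ∧ (∀ z, z ∈ M ↔ z ≠ x ∧ z ≠ y) ∧
      G.part X = A.part x ∧ G.part Y = A.part y ∧ X ≠ Y ∧
      (∀ z ∈ M, G.part (g z) = A.part z ∧ G.col X (g z) = A.colour x z + 2 ∧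
        G.col Y (g z) = A.colour y z + 2) ∧
      ∀ z ∈ M, ∀ w ∈ M, z ≠ w → G.col (g z) (g w) = A.colour z w + 2 := by
  classical
  have : Nonempty G.V := ⟨(hgen.2.1 (A.part x)).nonempty.some⟩
  have := hO.1
  have := Fintype.ofFinite A.V
  obtain ⟨f1, a1, a2⟩ := realize_part hA (hO.2.2 {z | z ≠ x} (by
    rw [Set.ne_univ_iff_exists_notMem]; exact ⟨x, by simp⟩))
  obtain ⟨f2, b1, b2⟩ := realize_part hA (hO.2.2 {z | z ≠ y} (by
    rw [Set.ne_univ_iff_exists_notMem]; exact ⟨y, by simp⟩))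
  simp only [Set.mem_ofPred_eq] at a1 a2 b1 b2
  have hM : ∀ z, z ∈ (Finset.univ.filter (fun z : A.V => z ≠ x ∧ z ≠ y)).toList ↔ z ≠ x ∧ z ≠ y := by
    intro z; simp
  generalize hMd : (Finset.univ.filter (fun z : A.V => z ≠ x ∧ z ≠ y)).toList = M at hM
  obtain ⟨Y, c1, c2, c3⟩ := (G.toAS hG hgen).ext (M.map (fun z => (f1 z, f2 z))) [f2 x] (f1 y)
    (by
      intro p hp
      obtain ⟨z, hz, rfl⟩ := List.mem_map.1 hp
      have hz := (hM z).1 hz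
      change G.part _ = G.part _
      rw [a1 z hz.1, b1 z hz.2])
    (by
      intro p hp p' hp'
      obtain ⟨z, hz, rfl⟩ := List.mem_map.1 hp
      obtain ⟨w, hw, rfl⟩ := List.mem_map.1 hp'
      have hz := (hM z).1 hz
      have hw := (hM w).1 hw
      change G.col _ _ = G.col _ _
      by_cases e : z = w
      · subst e
        rw [(G.col_zero _ _).2 rfl, (G.col_zero _ _).2 rfl]
      · rw [a2 z hz.1 w hw.1 e, b2 z hz.2 w hw.2 e])
    (by
      intro p hp e
      obtain ⟨z, hz, rfl⟩ := List.mem_map.1 hp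
      have hz := (hM z).1 hz
      have h1 := a2 y hxy.symm z hz.1 hz.2.symm
      rw [(G.col_zero _ _).2 e] at h1
      omega)
  refine ⟨f2 x, Y, f2, M, hMd ▸ Finset.nodup_toList _, hM, b1 x hxy, ?_, ?_, ?_, ?_⟩
  · have c2 : G.part Y = G.part (f1 y) := c2
    rw [c2, a1 y hxy.symm]
  · exact (c1 _ (by simp)).symm
  · intro z hz
    have hz' := (hM z).1 hz
    refine ⟨b1 z hz'.2, b2 x hxy z hz'.2 hz'.1.symm, ?_⟩
    have := c3 (f1 z, f2 z) (List.mem_map.2 ⟨z, hz, rfl⟩)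
    have : G.col Y (f2 z) = G.col (f1 y) (f1 z) := this
    rw [this, a2 y hxy.symm z hz'.1 hz'.2.symm]
  · intro z hz w hw hn
    exact b2 z ((hM z).1 hz).2 w ((hM w).1 hw).2 hn

theorem assemble {A : LGraph L} (hA : A.Monic) (x y : A.V) (X Y : G.V) (g : A.V → G.V)
    (hX : G.part X = A.part x) (hY : G.part Y = A.part y) (hXY : G.col X Y = A.colour x y + 2)
    (h1 : ∀ z, z ≠ x → z ≠ y → G.part (g z) = A.part z ∧ G.col X (g z) = A.colour x z + 2 ∧
        G.col Y (g z) = A.colour y z + 2)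
    (h2 : ∀ z, z ≠ x → z ≠ y → ∀ w, w ≠ x → w ≠ y → z ≠ w →
      G.col (g z) (g w) = A.colour z w + 2) : G.Realized A := by
  classical
  have sy := A.colour_symm
  have sc := G.col_symm
  let f : A.V → G.V := fun z => if z = x then X else if z = y then Y else g z
  have hp : ∀ z, G.part (f z) = A.part z := by
    intro z
    by_cases e : z = x
    · simp only [f, e, if_true, hX]
    · by_cases e' : z = y
      · subst e'
        simp only [f, if_neg e, if_true, hY]
      · simp only [f, if_neg e, if_neg e', (h1 z e e').1]
  have hc : ∀ z w, z ≠ w → G.col (f z) (f w) = A.colour z w + 2 := by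
    intro z w hn
    simp only [f]
    split_ifs <;> grind
  refine ⟨f, ?_, hp, ?_⟩
  · intro z w e
    by_contra hn
    have := hc z w hn
    rw [(G.col_zero _ _).2 e] at this
    omega
  · intro z w hn
    have := hc z w (fun e => hn (by rw [e]))
    rw [G.col_diff _ _ (by rwa [hp, hp])] at this
    omega

end


theorem compat_same {G : LGraph L} (hG : G.Homogeneous) (hgen : G.Generic) {i j k : Fin m}
    (hij : i ≠ j) (hik : i ≠ k) (hjk : j ≠ k) {cik cil cjk cjl : ℕ}
    (hcik : cik ∈ L.C i k) (hcil : cil ∈ L.C i k) (hcjk : cjk ∈ L.C j k) (hcjl : cjl ∈ L.C j k) :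
    ∃ d, (G.toAS hG hgen).R3 i j k d (cik + 2) (cjk + 2) ∧
      (G.toAS hG hgen).R3 i j k d (cil + 2) (cjl + 2) := by
  classical
  obtain ⟨u, hu⟩ := (hgen.2.1 k).nonempty
  obtain ⟨w, hw, hwu⟩ := ((hgen.2.1 k).sdiff (Set.finite_singleton u)).nonempty
  have hu : G.part u = k := hu
  have hw : G.part w = k := hw
  have hwu : w ≠ u := hwu
  obtain ⟨X, x1, x2⟩ := hgen.2.2 k i hik.symm {u, w} (by simp [hu, hw])
    (fun v => if v = u then cik else cil) (by
      rw [L.symm]; intro v _; split_ifs <;> assumption)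
  obtain ⟨Y, y1, y2⟩ := hgen.2.2 k j hjk.symm {u, w} (by simp [hu, hw])
    (fun v => if v = u then cjk else cjl) (by
      rw [L.symm]; intro v _; split_ifs <;> assumption)
  have xu := x2 u (by simp)
  have xw := x2 w (by simp)
  have yu := y2 u (by simp)
  have yw := y2 w (by simp)
  simp only [if_true, if_neg hwu] at xu xw yu yw
  have h0 : G.col X Y ≠ 0 := by
    rw [G.col_diff _ _ (by rwa [x1, y1])]; omega
  refine ⟨G.col X Y, ⟨X, Y, u, x1, y1, hu, rfl, ?_, ?_, h0, by omega, by omega⟩,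
    ⟨X, Y, w, x1, y1, hw, rfl, ?_, ?_, h0, by omega, by omega⟩⟩
  · rw [toAS_c, G.col_diff _ _ (by rwa [x1, hu]), xu]
  · rw [toAS_c, G.col_diff _ _ (by rwa [y1, hu]), yu]
  · rw [toAS_c, G.col_diff _ _ (by rwa [x1, hw]), xw]
  · rw [toAS_c, G.col_diff _ _ (by rwa [y1, hw]), yw]

theorem omission_of_incompat {G : LGraph L} (hG : G.Homogeneous) (hgen : G.Generic) {i j k l : Fin m}
    (hij : i ≠ j) (hik : i ≠ k) (hjk : j ≠ k) (hil : i ≠ l) (hjl : j ≠ l) (hkl : k ≠ l)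
    {cik cil cjk cjl : ℕ}
    (hcik : cik ∈ L.C i k) (hcil : cil ∈ L.C i l) (hcjk : cjk ∈ L.C j k) (hcjl : cjl ∈ L.C j l)
    (H : ¬ ∃ d, (G.toAS hG hgen).R3 i j k d (cik + 2) (cjk + 2) ∧
      (G.toAS hG hgen).R3 i j l d (cil + 2) (cjl + 2)) :
    ∃ S : Set (LGraph L), (∀ A ∈ S, G.MinOmitted A) ∧ IsOmissionSet S i j k l cik cil cjk cjl := by
  refine ⟨{B | G.MinOmitted B ∧ ((B.IsTriangleOn i j k ∧
      (∀ x y : B.V, B.part x = i → B.part y = k → B.colour x y = cik) ∧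
      (∀ x y : B.V, B.part x = j → B.part y = k → B.colour x y = cjk)) ∨ (B.IsTriangleOn i j l ∧
      (∀ x y : B.V, B.part x = i → B.part y = l → B.colour x y = cil) ∧
      (∀ x y : B.V, B.part x = j → B.part y = l → B.colour x y = cjl)))}, fun A hA => hA.1,
    ⟨?_, ?_⟩, ?_, ?_, ?_, ?_, ?_⟩
  · rintro A ⟨_, h | h⟩
    · exact h.1.1
    · exact h.1.1
  · intro c hc
    by_cases h : (G.toAS hG hgen).R3 i j k (c + 2) (cik + 2) (cjk + 2)
    · have h' : ¬ (G.toAS hG hgen).R3 i j l (c + 2) (cil + 2) (cjl + 2) := fun h' => H ⟨_, h, h'⟩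
      obtain ⟨B, b1, b2, b3, b4, b5⟩ := tri_omit hG hgen hij hil hjl hc hcil hcjl h'
      exact ⟨B, ⟨b1, Or.inr ⟨b2, b4, b5⟩⟩, b3⟩
    · obtain ⟨B, b1, b2, b3, b4, b5⟩ := tri_omit hG hgen hij hik hjk hc hcik hcjk h
      exact ⟨B, ⟨b1, Or.inl ⟨b2, b4, b5⟩⟩, b3⟩
  · rintro A ⟨_, h | h⟩
    · exact Or.inl h.1
    · exact Or.inr h.1
  · rintro A ⟨_, h | h⟩ x y hx hy
    · exact h.2.1 x y hx hy
    · rcases h.1.2.1 y with e | e | e <;> grind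
  · rintro A ⟨_, h | h⟩ x y hx hy
    · rcases h.1.2.1 y with e | e | e <;> grind
    · exact h.2.1 x y hx hy
  · rintro A ⟨_, h | h⟩ x y hx hy
    · exact h.2.2 x y hx hy
    · rcases h.1.2.1 y with e | e | e <;> grind
  · rintro A ⟨_, h | h⟩ x y hx hy
    · rcases h.1.2.1 y with e | e | e <;> grind
    · exact h.2.2 x y hx hy

/-- Non-complication theorem: every `C_{ij}`-cover set contained in
`O(G)` of a homogeneous m-generic graph has, for some distinct `k, l ∉ {i,j}`, a
`C_{ij}^{kl}`-omission set in `O(G)` based on it. -/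
theorem noncomplication
    {m : ℕ} {L : MLang m} (hm : 2 ≤ m)
    (G : LGraph L) (hG : G.Homogeneous) (hgen : G.Generic)
    (i j : Fin m) (hij : i ≠ j)
    (𝒜 : Set (LGraph L)) (h𝒜 : ∀ A ∈ 𝒜, G.MinOmitted A)
    (hcov : IsCoverSet 𝒜 i j) :
    ∃ k l : Fin m, k ≠ l ∧ k ≠ i ∧ k ≠ j ∧ l ≠ i ∧ l ≠ j ∧
      ∃ S : Set (LGraph L), (∀ A ∈ S, G.MinOmitted A) ∧
        ∃ cik cil cjk cjl : ℕ, IsOmissionSet S i j k l cik cil cjk cjl ∧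
          BasedOn 𝒜 i j k l cik cil cjk cjl := by
  by_contra hcon
  have hpack : ∀ c : {c // c ∈ L.C i j}, ∃ (A : LGraph L) (x y : A.V) (X Y : G.V) (g : A.V → G.V)
      (M : List A.V), A ∈ 𝒜 ∧ A.Monic ∧ A.part x = i ∧ A.part y = j ∧ A.colour x y = c.1 ∧
      M.Nodup ∧ (∀ z, z ∈ M ↔ z ≠ x ∧ z ≠ y) ∧
      G.part X = A.part x ∧ G.part Y = A.part y ∧ X ≠ Y ∧
      (∀ z ∈ M, G.part (g z) = A.part z ∧ G.col X (g z) = A.colour x z + 2 ∧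
        G.col Y (g z) = A.colour y z + 2) ∧
      ∀ z ∈ M, ∀ w ∈ M, z ≠ w → G.col (g z) (g w) = A.colour z w + 2 := by
    rintro ⟨c, hc⟩
    obtain ⟨A, hA, x, y, hx, hy, hxy⟩ := hcov.2 c hc
    have hmon := hcov.1 A hA
    obtain ⟨X, Y, g, M, h⟩ := realize hG hgen hmon (h𝒜 A hA) (x := x) (y := y)
      (by rintro rfl; exact hij (hx.symm.trans hy))
    exact ⟨A, x, y, X, Y, g, M, hA, hmon, hx, hy, hxy, h⟩
  choose A x y X Y g M hA hmon hx hy hxy hMn hM hX hY hXY hg hgg using hpack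
  have hne : Nonempty {c // c ∈ L.C i j} := by
    obtain ⟨c, hc⟩ := L.nonempty i j hij
    exact ⟨⟨c, hc⟩⟩
  have hdi : ∀ c, ∀ z ∈ M c, i ≠ (A c).part z ∧ j ≠ (A c).part z := by
    intro c z hz
    have hz := (hM c z).1 hz
    exact ⟨fun e => hz.1 (hmon c _ _ (by rw [← e, hx])), fun e => hz.2 (hmon c _ _ (by rw [← e, hy]))⟩
  have hmi : ∀ c, ∀ z ∈ M c, (A c).colour (x c) z ∈ L.C i ((A c).part z) := by
    intro c z hz
    have := (A c).colour_mem (x c) z (by rw [hx]; exact (hdi c z hz).1)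
    rwa [hx] at this
  have hmj : ∀ c, ∀ z ∈ M c, (A c).colour (y c) z ∈ L.C j ((A c).part z) := by
    intro c z hz
    have := (A c).colour_mem (y c) z (by rw [hy]; exact (hdi c z hz).2)
    rwa [hy] at this
  obtain ⟨d, hd⟩ := AS.goal (ι := {c // c ∈ L.C i j}) _ (G.toAS hG hgen) i j X Y
    (fun c => (M c).map (g c)) rfl (fun c => (hX c).trans (hx c)) (fun c => (hY c).trans (hy c))
    (by
      intro c
      simp only [List.nodup_cons, List.mem_cons, List.mem_map, not_or, not_exists, not_and]
      refine ⟨⟨hXY c, fun z hz e => ?_⟩, fun z hz e => ?_, ?_⟩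
      · have := (hg c z hz).2.1
        rw [(G.col_zero _ _).2 e.symm] at this
        omega
      · have := (hg c z hz).2.2
        rw [(G.col_zero _ _).2 e.symm] at this
        omega
      · refine List.Nodup.map_on (fun z hz w hw e => ?_) (hMn c)
        by_contra hn
        have := hgg c z hz w hw hn
        rw [(G.col_zero _ _).2 e] at this
        omega)
    (by
      intro c c' z' hz' w' hw'
      obtain ⟨z, hz, rfl⟩ := List.mem_map.1 hz'
      obtain ⟨w, hw, rfl⟩ := List.mem_map.1 hw'
      have key : ∃ d, (G.toAS hG hgen).R3 i j ((A c).part z) d ((A c).colour (x c) z + 2)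
            ((A c).colour (y c) z + 2) ∧
          (G.toAS hG hgen).R3 i j ((A c').part w) d ((A c').colour (x c') w + 2)
            ((A c').colour (y c') w + 2) := by
        have a1 := hdi c z hz
        have a2 := hdi c' w hw
        have b1 := hmi c z hz
        have b2 := hmi c' w hw
        have b3 := hmj c z hz
        have b4 := hmj c' w hw
        by_cases e : (A c).part z = (A c').part w
        · rw [← e] at b2 b4 ⊢
          exact compat_same hG hgen hij a1.1 a1.2 b1 b2 b3 b4
        · by_contra H
          obtain ⟨S, s1, s2⟩ := omission_of_incompat hG hgen hij a1.1 a1.2 a2.1 a2.2 e b1 b2 b3 b4 H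
          exact hcon ⟨_, _, e, a1.1.symm, a1.2.symm, a2.1.symm, a2.2.symm, S, s1, _, _, _, _, s2,
            A c, hA c, A c', hA c', ⟨x c, z, hx c, rfl, rfl⟩, ⟨y c, z, hy c, rfl, rfl⟩,
            ⟨x c', w, hx c', rfl, rfl⟩, ⟨y c', w, hy c', rfl, rfl⟩⟩
      obtain ⟨d, d1, d2⟩ := key
      refine ⟨d, ?_, ?_⟩
      · unfold AS.Q
        simp only [toAS_τ, toAS_c]
        rw [hX, hY, hx, hy, (hg c z hz).1, (hg c z hz).2.1, (hg c z hz).2.2]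
        exact d1
      · unfold AS.Q
        simp only [toAS_τ, toAS_c]
        rw [hX, hY, hx, hy, (hg c' w hw).1, (hg c' w hw).2.1, (hg c' w hw).2.2]
        exact d2)
  obtain ⟨c0⟩ := hne
  obtain ⟨_, X0, Y0, p1, p2, p3, _⟩ := hd c0
  simp only [toAS_τ, toAS_c] at p1 p2 p3
  have q1 : G.part X0 = i := by rw [p1, hX, hx]
  have q2 : G.part Y0 = j := by rw [p2, hY, hy]
  have hmem := G.colour_mem X0 Y0 (by rwa [q1, q2])
  rw [G.col_diff _ _ (by rwa [q1, q2])] at p3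
  rw [q1, q2] at hmem
  generalize G.colour X0 Y0 = c at p3 hmem
  obtain ⟨_, X', Y', r1, r2, r3, r4⟩ := hd ⟨c, hmem⟩
  simp only [toAS_τ, toAS_c] at r1 r2 r3 r4
  have hc := hxy ⟨c, hmem⟩
  have hO := h𝒜 _ (hA ⟨c, hmem⟩)
  rw [hX] at r1
  rw [hY] at r2
  refine hO.2.1 (assemble (hmon _) (x _) (y _) X' Y' (g _) r1 r2 (by rw [hc, r3, ← p3]) ?_ ?_)
  · intro z z1 z2
    have hz := (hM ⟨c, hmem⟩ z).2 ⟨z1, z2⟩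
    have h1 := r4 (g _ z) (List.mem_map.2 ⟨z, hz, rfl⟩)
    have h2 := hg _ z hz
    exact ⟨h2.1, h1.1.trans h2.2.1, h1.2.trans h2.2.2⟩
  · intro z z1 z2 w w1 w2 hn
    exact hgg _ z ((hM ⟨c, hmem⟩ z).2 ⟨z1, z2⟩) w ((hM ⟨c, hmem⟩ w).2 ⟨w1, w2⟩) hn
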